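/- arXiv:0901.4616 — 3 statements merged into one kernel-verified Lean document; each statement's English description precedes it below -/
import Mathlib

section
/- Let G be a d-regular graph whose simple random walk satisfies ⟨f,(I−P)f⟩ ≥ λ₁⟨f,f⟩ for all f ∈ ℓ²(G) with λ₁ > 0, and let g̃ = ⌈g/2⌉ − 1 where g is the girth. Then for every finite nonempty set A of vertices, there exist at least (λ₁ d/2)·|A| directed edges (x,u) with x ∈ A such that at least a λ₁/2 fraction of the (d−1)^{g̃} non-backtracking paths of length g̃ starting with the step from x to u (continuing from u) avoid A entirely after the first step. -/
/-- Non-backtracking paths of length `k` in `G` starting at `u`, encoded as functions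
`ℕ → V` that are constant past time `k`. -/
def NBPathsFrom {V : Type*} (G : SimpleGraph V) (u : V) (k : ℕ) : Set (ℕ → V) :=
  {p | p 0 = u ∧ (∀ i, i < k → G.Adj (p i) (p (i + 1))) ∧
    (∀ i, i + 2 ≤ k → p (i + 2) ≠ p i) ∧ ∀ i, k ≤ i → p i = p k}

/-- The directed edge `(x, u)` is `(α, A)`-good: `x ∈ A` and at least an `α` fraction of the
`(d-1)^k` non-backtracking paths of length `k` emanating from `u` whose first step is not `x`
avoid `A` entirely. -/
def IsGoodEdge {V : Type*} (G : SimpleGraph V) (d k : ℕ) (α : ℝ) (A : Set V) (x u : V) :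
    Prop :=
  x ∈ A ∧ G.Adj x u ∧
    α * ((d : ℝ) - 1) ^ k ≤
      ({p ∈ NBPathsFrom G u k | p 1 ≠ x ∧ ∀ i, p i ∉ A}.ncard : ℝ)

open scoped Classical in
/-- `lam` is a lower bound for the bottom of the spectrum of `I - P` on `ℓ²(V)`, where `P` is
the transition matrix of simple random walk on the `d`-regular graph `G`. -/
def SRWSpectralGap {V : Type*} (G : SimpleGraph V) (d : ℕ) (lam : ℝ) : Prop :=
  ∀ f : V → ℝ, Summable (fun x => f x ^ 2) →
    lam * ∑' x, f x ^ 2 ≤ ∑' x, f x * (f x - ∑' y, if G.Adj x y then f y / d else 0)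

open scoped Classical in
/-- The probability that simple random walk on the `d`-regular graph `G` started at `v` does not
visit `A` at any of the times `0, …, n`. -/
noncomputable def avoidProb {V : Type*} (G : SimpleGraph V) [G.LocallyFinite] (d : ℕ)
    (A : Set V) : ℕ → V → ℝ
  | 0, v => if v ∈ A then 0 else 1
  | n + 1, v => if v ∈ A then 0 else (∑ w ∈ G.neighborFinset v, avoidProb G d A n w) / d

section avoidProb

variable {V : Type*} {G : SimpleGraph V} [G.LocallyFinite] {d : ℕ} {A : Set V}

lemma avoidProb_of_mem (n : ℕ) {v : V} (hv : v ∈ A) : avoidProb G d A n v = 0 := by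
  cases n <;> simp [avoidProb, hv]

lemma avoidProb_succ (n : ℕ) {v : V} (hv : v ∉ A) :
    avoidProb G d A (n + 1) v = (∑ w ∈ G.neighborFinset v, avoidProb G d A n w) / d := by
  simp [avoidProb, hv]

lemma avoidProb_nonneg (n : ℕ) (v : V) : 0 ≤ avoidProb G d A n v := by
  induction n generalizing v with
  | zero => unfold avoidProb; split_ifs <;> norm_num
  | succ n ih =>
    unfold avoidProb
    split_ifs
    · exact le_rfl
    · exact div_nonneg (Finset.sum_nonneg fun w _ => ih w) d.cast_nonneg

lemma avoidProb_le_one (hreg : G.IsRegularOfDegree d) (n : ℕ) (v : V) :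
    avoidProb G d A n v ≤ 1 := by
  induction n generalizing v with
  | zero => unfold avoidProb; split_ifs <;> norm_num
  | succ n ih =>
    unfold avoidProb
    split_ifs
    · exact zero_le_one
    · refine div_le_one_of_le₀ ?_ d.cast_nonneg
      refine (Finset.sum_le_sum fun w _ => ih w).trans ?_
      simp [hreg.degree_eq]

lemma avoidProb_succ_le (hreg : G.IsRegularOfDegree d) (n : ℕ) (v : V) :
    avoidProb G d A (n + 1) v ≤ avoidProb G d A n v := by
  by_cases hv : v ∈ A
  · simp [avoidProb_of_mem _ hv]
  induction n generalizing v with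
  | zero => exact (avoidProb_le_one hreg 1 v).trans (by simp [avoidProb, hv])
  | succ n ih =>
    rw [avoidProb_succ _ hv, avoidProb_succ _ hv]
    refine div_le_div_of_nonneg_right (Finset.sum_le_sum fun w _ => ?_) d.cast_nonneg
    by_cases hw : w ∈ A
    · simp [avoidProb_of_mem _ hw]
    · exact ih w hw

lemma finite_setOf_avoidProb_ne_one (hreg : G.IsRegularOfDegree d) (hd : 0 < d)
    (hA : A.Finite) (n : ℕ) : {v | avoidProb G d A n v ≠ 1}.Finite := by
  induction n with
  | zero =>
    refine hA.subset fun v hv => ?_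
    by_contra h
    simp [avoidProb, h] at hv
  | succ n ih =>
    refine (hA.union (ih.biUnion fun v _ => (G.neighborFinset v).finite_toSet)).subset
      fun v hv => ?_
    by_contra h
    simp only [Set.mem_union, Set.mem_iUnion, not_or, not_exists, Finset.mem_coe,
      SimpleGraph.mem_neighborFinset] at h
    refine hv ?_
    rw [avoidProb_succ _ h.1, Finset.sum_congr rfl (g := fun _ => (1 : ℝ))]
    · have : (d : ℝ) ≠ 0 := by positivity
      simp [hreg.degree_eq, this]
    · intro w hw
      by_contra hne
      exact h.2 w hne ((G.mem_neighborFinset v w).1 hw).symm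

/-- The average over `A` of the probability of leaving `A` for at least `n + 1` steps is bounded
below by the spectral gap. -/
lemma SRWSpectralGap.le_sum_avoidProb (hreg : G.IsRegularOfDegree d) (hd : 0 < d) {lam : ℝ}
    (hlam : 0 ≤ lam) (hgap : SRWSpectralGap G d lam) (A : Finset V) (n : ℕ) :
    lam * d * A.card ≤ ∑ x ∈ A, ∑ u ∈ G.neighborFinset x, avoidProb G d A n u := by
  classical
  have hd' : (0 : ℝ) < d := by exact_mod_cast hd
  set q := avoidProb G d (A : Set V) n with hq
  obtain ⟨B, hB⟩ := (finite_setOf_avoidProb_ne_one hreg hd A.finite_toSet n).exists_finset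
  have hoff : ∀ v ∉ B, q v = 1 := fun v hv => by simpa [hB] using hv
  have hAB : A ⊆ B := fun v hv => (hB v).2 (by
    simp [avoidProb_of_mem (G := G) (d := d) n (Finset.mem_coe.2 hv)])
  have hP : ∀ x, (∑' y, if G.Adj x y then (1 - q y) / d else 0)
      = 1 - (∑ y ∈ G.neighborFinset x, q y) / d := fun x => by
    rw [tsum_eq_sum (s := G.neighborFinset x) (fun y hy => by
      rw [SimpleGraph.mem_neighborFinset] at hy; simp [hy])]
    rw [Finset.sum_congr rfl (g := fun y => (1 - q y) / d) (fun y hy => by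
      rw [SimpleGraph.mem_neighborFinset] at hy; simp [hy])]
    rw [← Finset.sum_div, Finset.sum_sub_distrib]
    simp only [Finset.sum_const, SimpleGraph.card_neighborFinset_eq_degree, hreg.degree_eq]
    field_simp
    simp
  have key := hgap (fun v => 1 - q v)
    (summable_of_ne_finset_zero (s := B) fun v hv => by simp [hoff v hv])
  simp only [hP] at key
  rw [tsum_eq_sum (s := B) fun v hv => by simp [hoff v hv],
    tsum_eq_sum (s := B) fun v hv => by simp [hoff v hv]] at key
  have hlow : (A.card : ℝ) ≤ ∑ v ∈ B, (1 - q v) ^ 2 := by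
    calc (A.card : ℝ) = ∑ v ∈ A, (1 - q v) ^ 2 := by
          rw [Finset.sum_congr rfl (g := fun _ => (1 : ℝ))]
          · simp
          · intro v hv
            simp [hq, avoidProb_of_mem n (Finset.mem_coe.2 hv)]
      _ ≤ _ := Finset.sum_le_sum_of_subset_of_nonneg hAB fun _ _ _ => sq_nonneg _
  have hup : ∑ x ∈ B, (1 - q x) * (1 - q x - (1 - (∑ y ∈ G.neighborFinset x, q y) / d))
      ≤ ∑ x ∈ A, (∑ u ∈ G.neighborFinset x, q u) / d := by
    rw [← Finset.sum_sdiff hAB]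
    have h1 : ∑ x ∈ B \ A, (1 - q x) * (1 - q x - (1 - (∑ y ∈ G.neighborFinset x, q y) / d))
        ≤ 0 := by
      refine Finset.sum_nonpos fun x hx => ?_
      have hxA : x ∉ (A : Set V) := by simpa using (Finset.mem_sdiff.1 hx).2
      rw [hq, ← avoidProb_succ n hxA]
      refine mul_nonpos_of_nonneg_of_nonpos ?_ ?_
      · linarith [avoidProb_le_one (A := (A : Set V)) hreg n x]
      · linarith [avoidProb_succ_le (A := (A : Set V)) hreg n x]
    have h2 : ∑ x ∈ A, (1 - q x) * (1 - q x - (1 - (∑ y ∈ G.neighborFinset x, q y) / d))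
        = ∑ x ∈ A, (∑ u ∈ G.neighborFinset x, q u) / d := by
      refine Finset.sum_congr rfl fun x hx => ?_
      have : q x = 0 := avoidProb_of_mem n (Finset.mem_coe.2 hx)
      rw [this]; ring
    linarith
  have := (mul_le_mul_of_nonneg_left hlow hlam).trans (key.trans hup)
  rw [← Finset.sum_div, le_div_iff₀ hd'] at this
  linarith

/-- The probability that simple random walk started at `v` never visits `A`. -/
noncomputable def escapeProb {V : Type*} (G : SimpleGraph V) [G.LocallyFinite] (d : ℕ)
    (A : Set V) (v : V) : ℝ :=
  ⨅ n, avoidProb G d A n v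

lemma tendsto_avoidProb (hreg : G.IsRegularOfDegree d) (v : V) :
    Filter.Tendsto (fun n => avoidProb G d A n v) Filter.atTop (nhds (escapeProb G d A v)) :=
  tendsto_atTop_ciInf (antitone_nat_of_succ_le fun n => avoidProb_succ_le hreg n v)
    ⟨0, by rintro _ ⟨n, rfl⟩; exact avoidProb_nonneg n v⟩

lemma escapeProb_nonneg (v : V) : 0 ≤ escapeProb G d A v :=
  le_ciInf fun n => avoidProb_nonneg n v

lemma escapeProb_le_one (hreg : G.IsRegularOfDegree d) (v : V) : escapeProb G d A v ≤ 1 :=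
  le_of_tendsto' (tendsto_avoidProb hreg v) fun n => avoidProb_le_one hreg n v

lemma escapeProb_of_mem {v : V} (hv : v ∈ A) : escapeProb G d A v = 0 := by
  simp [escapeProb, avoidProb_of_mem _ hv]

lemma escapeProb_eq (hreg : G.IsRegularOfDegree d) {v : V} (hv : v ∉ A) :
    escapeProb G d A v = (∑ w ∈ G.neighborFinset v, escapeProb G d A w) / d := by
  refine tendsto_nhds_unique ((tendsto_avoidProb hreg v).comp (Filter.tendsto_add_atTop_nat 1)) ?_
  simp only [Function.comp_def, avoidProb_succ _ hv]
  exact (tendsto_finsetSum _ fun w _ => tendsto_avoidProb hreg w).div_const _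

lemma SRWSpectralGap.le_sum_escapeProb (hreg : G.IsRegularOfDegree d) (hd : 0 < d) {lam : ℝ}
    (hlam : 0 ≤ lam) (hgap : SRWSpectralGap G d lam) (A : Finset V) :
    lam * d * A.card ≤ ∑ x ∈ A, ∑ u ∈ G.neighborFinset x, escapeProb G d A u :=
  ge_of_tendsto'
    (tendsto_finsetSum _ fun _ _ => tendsto_finsetSum _ fun u _ => tendsto_avoidProb hreg u)
    fun n => hgap.le_sum_avoidProb hreg hd hlam A n

end avoidProb

open scoped Classical in
/-- The non-backtracking paths of length `k` starting at `u`, not stepping first to `x`, which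
avoid `A`. -/
noncomputable def avoidingPaths {V : Type*} (G : SimpleGraph V) [G.LocallyFinite] (A : Set V) :
    ℕ → V → V → Finset (ℕ → V)
  | 0, _, u => if u ∈ A then ∅ else {fun _ => u}
  | k + 1, x, u => if u ∈ A then ∅ else
      ((G.neighborFinset u).erase x).biUnion fun w =>
        (avoidingPaths G A k u w).image fun p n => Nat.casesOn n u p

section avoidingPaths

variable {V : Type*} {G : SimpleGraph V} [G.LocallyFinite] {d : ℕ} {A : Set V}

lemma apply_zero_of_mem_avoidingPaths {k : ℕ} {x u : V} {p : ℕ → V}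
    (hp : p ∈ avoidingPaths G A k x u) : p 0 = u := by
  cases k with
  | zero =>
    unfold avoidingPaths at hp
    split_ifs at hp
    · simp at hp
    · rw [Finset.mem_singleton.1 hp]
  | succ k =>
    unfold avoidingPaths at hp
    split_ifs at hp
    · simp at hp
    · simp only [Finset.mem_biUnion, Finset.mem_image] at hp
      obtain ⟨w, -, r, -, rfl⟩ := hp
      rfl

lemma mem_avoidingPaths_succ {k : ℕ} {x u : V} (hu : u ∉ A) {p : ℕ → V} :
    p ∈ avoidingPaths G A (k + 1) x u ↔ p 0 = u ∧ p 1 ≠ x ∧ G.Adj u (p 1) ∧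
      (fun n => p (n + 1)) ∈ avoidingPaths G A k u (p 1) := by
  simp only [avoidingPaths, hu, if_false, Finset.mem_biUnion, Finset.mem_image, Finset.mem_erase,
    SimpleGraph.mem_neighborFinset]
  constructor
  · rintro ⟨w, ⟨hwx, hw⟩, r, hr, rfl⟩
    have := apply_zero_of_mem_avoidingPaths hr
    subst this
    exact ⟨rfl, hwx, hw, hr⟩
  · rintro ⟨h0, h1, h2, h3⟩
    refine ⟨p 1, ⟨h1, h2⟩, _, h3, ?_⟩
    funext n
    cases n with
    | zero => exact h0.symm
    | succ n => rfl

lemma card_avoidingPaths_succ {k : ℕ} {x u : V} (hu : u ∉ A) [DecidableEq V] :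
    (avoidingPaths G A (k + 1) x u).card
      = ∑ w ∈ (G.neighborFinset u).erase x, (avoidingPaths G A k u w).card := by
  classical
  simp only [avoidingPaths, hu, if_false]
  rw [Finset.card_biUnion]
  · refine Finset.sum_congr (by congr!) fun w _ => Finset.card_image_of_injective _ ?_
    intro p r h
    funext n
    exact congrFun h (n + 1)
  · intro w _ w' _ hne
    rw [Function.onFun, Finset.disjoint_left]
    simp only [Finset.mem_image]
    rintro _ ⟨p, hp, rfl⟩ ⟨r, hr, h⟩
    refine hne ?_
    rw [← apply_zero_of_mem_avoidingPaths hp, ← apply_zero_of_mem_avoidingPaths hr]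
    exact (congrFun h 1).symm

lemma avoidingPaths_of_mem {k : ℕ} {x u : V} (hu : u ∈ A) : avoidingPaths G A k x u = ∅ := by
  cases k <;> simp [avoidingPaths, hu]

lemma coe_avoidingPaths (k : ℕ) {x u : V} (hxu : G.Adj x u) :
    (avoidingPaths G A k x u : Set (ℕ → V))
      = {p ∈ NBPathsFrom G u k | p 1 ≠ x ∧ ∀ i, p i ∉ A} := by
  ext p
  simp only [Finset.mem_coe]
  by_cases hu : u ∈ A
  · rw [avoidingPaths_of_mem hu]
    simp only [Finset.notMem_empty, false_iff]
    rintro ⟨⟨h0, -⟩, -, h⟩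
    exact h 0 (h0 ▸ hu)
  induction k generalizing x u p with
  | zero =>
    simp only [avoidingPaths, hu, if_false, Finset.mem_singleton]
    constructor
    · rintro rfl
      exact ⟨⟨rfl, by simp, by simp, by simp⟩, hxu.ne', fun _ => hu⟩
    · rintro ⟨⟨h0, -, -, h⟩, -, -⟩
      funext i
      rw [h i i.zero_le, h0]
  | succ k ih =>
    rw [mem_avoidingPaths_succ hu]
    constructor
    · rintro ⟨h0, h1, hadj, hp⟩
      have hpA : p 1 ∉ A := fun h => by simp [avoidingPaths_of_mem h] at hp
      obtain ⟨⟨-, ha, hb, hc⟩, h2, hA⟩ := (ih hadj _ hpA).1 hp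
      refine ⟨⟨h0, ?_, ?_, ?_⟩, h1, ?_⟩
      · rintro (_ | i) hi
        · rwa [h0]
        · exact ha i (by omega)
      · rintro (_ | i) hi
        · rw [h0]; exact h2
        · exact hb i (by omega)
      · rintro (_ | i) hi
        · omega
        · exact hc i (by omega)
      · rintro (_ | i)
        · rwa [h0]
        · exact hA i
    · rintro ⟨⟨h0, ha, hb, hc⟩, h1, hA⟩
      have hadj : G.Adj u (p 1) := h0 ▸ ha 0 k.succ_pos
      refine ⟨h0, h1, hadj, (ih hadj _ (hA 1)).2
        ⟨⟨rfl, fun i hi => ha (i + 1) (by omega), fun i hi => hb (i + 1) (by omega),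
          fun i hi => hc (i + 1) (by omega)⟩, ?_, fun i => hA (i + 1)⟩⟩
      rcases Nat.eq_zero_or_pos k with rfl | hk
      · have : p 2 = p 1 := hc 2 (by omega)
        exact (this.trans_ne hadj.ne')
      · exact h0 ▸ hb 0 (by omega)

lemma card_erase_neighborFinset [DecidableEq V] (hreg : G.IsRegularOfDegree d) (hd : 0 < d)
    {x u : V} (hxu : G.Adj x u) : (((G.neighborFinset u).erase x).card : ℝ) = d - 1 := by
  rw [Finset.card_erase_of_mem ((G.mem_neighborFinset u x).2 hxu.symm),
    SimpleGraph.card_neighborFinset_eq_degree, hreg.degree_eq, Nat.cast_sub hd, Nat.cast_one]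

lemma card_avoidingPaths_le (hreg : G.IsRegularOfDegree d) (hd : 0 < d) (k : ℕ) {x u : V}
    (hxu : G.Adj x u) : ((avoidingPaths G A k x u).card : ℝ) ≤ ((d : ℝ) - 1) ^ k := by
  classical
  have hd' : (0 : ℝ) ≤ d - 1 := by
    rw [sub_nonneg]; exact_mod_cast hd
  by_cases hu : u ∈ A
  · simpa [avoidingPaths_of_mem hu] using pow_nonneg hd' k
  induction k generalizing x u with
  | zero => simp [avoidingPaths, hu]
  | succ k ih =>
    rw [card_avoidingPaths_succ hu, Nat.cast_sum, pow_succ', ← card_erase_neighborFinset hreg hd hxu,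
      ← nsmul_eq_mul, ← Finset.sum_const]
    refine Finset.sum_le_sum fun w hw => ?_
    have hw' := (G.mem_neighborFinset u w).1 (Finset.mem_of_mem_erase hw)
    rw [card_erase_neighborFinset hreg hd hxu]
    by_cases hwA : w ∈ A
    · simpa [avoidingPaths_of_mem hwA] using pow_nonneg hd' k
    · exact ih hw' hwA

/-- A walk started at `u` that never visits `A` either visits `x`, or follows one of the
non-backtracking paths from `u` that avoid `A`. -/
lemma escapeProb_le (hreg : G.IsRegularOfDegree d) (hd : 1 < d) (k : ℕ) {x u : V}
    (hxu : G.Adj x u) :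
    escapeProb G d A u ≤ escapeProb G d A x / ((d : ℝ) - 1)
      + (avoidingPaths G A k x u).card / ((d : ℝ) - 1) ^ k := by
  classical
  have hd1 : (1 : ℝ) < d := by exact_mod_cast hd
  have hd' : (0 : ℝ) < d - 1 := sub_pos.2 hd1
  have hnn : ∀ k (x u : V), 0 ≤ escapeProb G d A x / ((d : ℝ) - 1)
      + (avoidingPaths G A k x u).card / ((d : ℝ) - 1) ^ k := fun k x u => by
    have := escapeProb_nonneg (G := G) (d := d) (A := A) x
    positivity
  induction k generalizing x u with
  | zero =>
    by_cases hu : u ∈ A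
    · rw [escapeProb_of_mem hu]; exact hnn _ _ _
    · have h1 := escapeProb_le_one (A := A) hreg u
      have h2 := div_nonneg (escapeProb_nonneg (G := G) (d := d) (A := A) x) hd'.le
      simp only [avoidingPaths, hu, if_false, Finset.card_singleton]
      norm_num
      linarith
  | succ k ih =>
    by_cases hu : u ∈ A
    · rw [escapeProb_of_mem hu]; exact hnn _ _ _
    have hq := escapeProb_eq (A := A) hreg hu
    rw [eq_div_iff (by positivity),
      ← Finset.add_sum_erase _ _ ((G.mem_neighborFinset u x).2 hxu.symm)] at hq
    have hsum : ∑ w ∈ (G.neighborFinset u).erase x, escapeProb G d A w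
        ≤ escapeProb G d A u + (avoidingPaths G A (k + 1) x u).card / ((d : ℝ) - 1) ^ k := by
      refine (Finset.sum_le_sum fun w hw =>
        ih ((G.mem_neighborFinset u w).1 (Finset.mem_of_mem_erase hw))).trans_eq ?_
      rw [Finset.sum_add_distrib, Finset.sum_const, nsmul_eq_mul,
        card_erase_neighborFinset hreg hd.le hxu, mul_div_cancel₀ _ hd'.ne', ← Finset.sum_div,
        card_avoidingPaths_succ hu, Nat.cast_sum]
    have hsplit : escapeProb G d A x / ((d : ℝ) - 1)
        + (avoidingPaths G A (k + 1) x u).card / ((d : ℝ) - 1) ^ (k + 1)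
        = (escapeProb G d A x + (avoidingPaths G A (k + 1) x u).card / ((d : ℝ) - 1) ^ k)
          / ((d : ℝ) - 1) := by
      rw [pow_succ]; field_simp
    rw [hsplit, le_div_iff₀ hd']
    linarith

end avoidingPaths

open scoped Classical in
/-- If numbers `f i ≤ 1` have total at least `c` times their number, then at least a proportion
`c / 2` of them are at least `c / 2`. -/
lemma Finset.half_mul_card_le_card_filter {ι : Type*} (s : Finset ι) {f : ι → ℝ} {c : ℝ}
    (hc : 0 ≤ c) (hf : ∀ i ∈ s, f i ≤ 1) (h : c * s.card ≤ ∑ i ∈ s, f i) :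
    c / 2 * s.card ≤ ((s.filter fun i => c / 2 ≤ f i).card : ℝ) := by
  have hle : ∑ i ∈ s, f i ≤ ∑ i ∈ s, ((if c / 2 ≤ f i then 1 else 0) + c / 2) := by
    refine Finset.sum_le_sum fun i hi => ?_
    split_ifs with hi'
    · linarith [hf i hi]
    · linarith
  rw [Finset.sum_add_distrib, Finset.sum_boole, Finset.sum_const, nsmul_eq_mul] at hle
  linarith

/-- if `G` is an infinite connected `d`-regular graph of girth `g` whose simple
random walk satisfies `⟨f,(I-P)f⟩ ≥ λ₁⟨f,f⟩` with `λ₁ > 0`, and `g̃ = ⌈g/2⌉ - 1`, then for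
every finite nonempty set `A` of vertices there are at least `(λ₁ d / 2)·|A|` directed edges
`(x, u)` that are `(λ₁/2, A)`-good. -/
theorem stmt_5 {V : Type*} [Infinite V] (G : SimpleGraph V) (hconn : G.Connected)
    (d g : ℕ) (hreg : ∀ v, (G.neighborSet v).ncard = d) (hg : G.egirth = (g : ℕ∞))
    (gt : ℕ) (hgt : gt = (g + 1) / 2 - 1)
    (lam : ℝ) (hlam : 0 < lam) (hgap : SRWSpectralGap G d lam)
    (A : Set V) (hAne : A.Nonempty) (hAfin : A.Finite) :
    lam * d / 2 * A.ncard ≤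
      ({e : V × V | IsGoodEdge G d gt (lam / 2) A e.1 e.2}.ncard : ℝ) := by
  classical
  rcases Nat.eq_zero_or_pos d with rfl | hd
  · simp
  let : G.LocallyFinite := fun v =>
    (Set.finite_of_ncard_pos (by rw [hreg v]; exact hd)).fintype
  have hdeg : G.IsRegularOfDegree d := fun v => by
    rw [← hreg v, Set.ncard_eq_toFinset_card', ← SimpleGraph.card_neighborFinset_eq_degree]
    rfl
  lift A to Finset V using hAfin
  have hgt0 : gt ≠ 0 := by
    have h3 : (3 : ℕ∞) ≤ g := hg ▸ G.three_le_egirth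
    have : 3 ≤ g := by exact_mod_cast h3
    omega
  have hgood : ∀ x u, IsGoodEdge G d gt (lam / 2) (A : Set V) x u ↔ x ∈ A ∧ G.Adj x u ∧
      lam / 2 * ((d : ℝ) - 1) ^ gt ≤ (avoidingPaths G (A : Set V) gt x u).card := fun x u => by
    rw [IsGoodEdge, Finset.mem_coe]
    refine and_congr_right fun _ => and_congr_right fun hxu => ?_
    rw [← coe_avoidingPaths gt hxu, Set.ncard_coe_finset]
  let E : Finset (Σ _ : V, V) := A.sigma fun x => G.neighborFinset x
  let f : (Σ _ : V, V) → ℝ := fun e =>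
    if d = 1 then 1 else (avoidingPaths G (A : Set V) gt e.1 e.2).card / ((d : ℝ) - 1) ^ gt
  have hE : (E.card : ℝ) = d * A.card := by
    simp [E, Finset.card_sigma, hdeg.degree_eq, mul_comm]
  have hadj : ∀ e ∈ E, e.1 ∈ A ∧ G.Adj e.1 e.2 := fun e he => by
    simpa [E, Finset.mem_sigma] using he
  have hpow : d ≠ 1 → (0 : ℝ) < ((d : ℝ) - 1) ^ gt := fun h => by
    have : (1 : ℝ) < d := by exact_mod_cast (by omega : 1 < d)
    exact pow_pos (by linarith) _
  have hf1 : ∀ e ∈ E, f e ≤ 1 := fun e he => by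
    simp only [f]
    split_ifs with h
    · exact le_rfl
    · exact (div_le_one (hpow h)).2 (card_avoidingPaths_le hdeg hd gt (hadj e he).2)
  have hfsum : lam * E.card ≤ ∑ e ∈ E, f e := by
    rw [hE, ← mul_assoc]
    refine (hgap.le_sum_escapeProb hdeg hd hlam.le A).trans ?_
    rw [Finset.sum_sigma']
    refine Finset.sum_le_sum fun e he => ?_
    simp only [f]
    split_ifs with h
    · exact escapeProb_le_one hdeg _
    · simpa [escapeProb_of_mem (G := G) (d := d) (Finset.mem_coe.2 (hadj e he).1)] using
        escapeProb_le (A := (A : Set V)) hdeg (by omega) gt (hadj e he).2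
  have hmain := E.half_mul_card_le_card_filter hlam.le hf1 hfsum
  have hfin : {e : V × V | IsGoodEdge G d gt (lam / 2) (A : Set V) e.1 e.2}.Finite := by
    refine (E.map (Equiv.sigmaEquivProd V V).toEmbedding).finite_toSet.subset ?_
    rintro ⟨x, u⟩ ⟨hx, hxu, -⟩
    simpa [E] using ⟨hx, hxu⟩
  have hsub : (((E.filter fun e => lam / 2 ≤ f e).map (Equiv.sigmaEquivProd V V).toEmbedding :
      Finset (V × V)) : Set (V × V))
      ⊆ {e : V × V | IsGoodEdge G d gt (lam / 2) (A : Set V) e.1 e.2} := by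
    intro e he
    obtain ⟨⟨x, u⟩, hxu, rfl⟩ := Finset.mem_map.1 he
    obtain ⟨hxE, hle⟩ := Finset.mem_filter.1 hxu
    refine (hgood x u).2 ⟨(hadj _ hxE).1, (hadj _ hxE).2, ?_⟩
    by_cases h : d = 1
    · simp [h, hgt0]
    · simpa [f, h, le_div_iff₀ (hpow h)] using hle
  have hcard := Set.ncard_le_ncard hsub hfin
  rw [Set.ncard_coe_finset, Finset.card_map] at hcard
  rw [Set.ncard_coe_finset]
  calc lam * d / 2 * A.card = lam / 2 * E.card := by rw [hE]; ring
    _ ≤ _ := hmain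
    _ ≤ _ := Nat.cast_le.2 hcard
end

section
/- Let G_n be finite graphs with |G_n| = n, maximum degree ≤ d, and Cheeger constant ≥ h > 0, converging weakly to a rooted infinite bounded-degree graph (G,ρ). If p > p_c(G), then there exists α > 0 such that P(G_n(p) contains a connected component of size ≥ αn) → 1 as n → ∞. -/
open MeasureTheory Filter

/-- An edge `s(a,b)` is open in the configuration `ω` and present in `G`. -/
def SimpleGraph.OpenAdj {V : Type*} (G : SimpleGraph V) (ω : Sym2 V → Bool) (a b : V) : Prop :=
  G.Adj a b ∧ ω s(a, b) = true

/-- `a` and `b` are joined by a path of open edges of `G`. -/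
def SimpleGraph.OpenConn {V : Type*} (G : SimpleGraph V) (ω : Sym2 V → Bool) (a b : V) : Prop :=
  Relation.ReflTransGen (G.OpenAdj ω) a b

/-- The configuration `ω` has an infinite open cluster in `G`. -/
def SimpleGraph.HasInfiniteCluster {V : Type*} (G : SimpleGraph V) (ω : Sym2 V → Bool) : Prop :=
  ∃ v, {w | G.OpenConn ω v w}.Infinite

/-- `μ` is the law of i.i.d. Bernoulli(`p`) random variables indexed by `E`. -/
def IsBernoulliConfig {E : Type*} (p : ℝ) (μ : Measure (E → Bool)) : Prop :=
  IsProbabilityMeasure μ ∧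
    ∀ (s : Finset E) (f : E → Bool),
      μ {ω | ∀ e ∈ s, ω e = f e} = ∏ e ∈ s, ENNReal.ofReal (if f e then p else 1 - p)

/-- The critical probability of Bernoulli bond percolation on `G`, defined relative to a
family `μ p` of Bernoulli(`p`) percolation measures. -/
noncomputable def percThreshold {V : Type*} (G : SimpleGraph V)
    (μ : ℝ → Measure (Sym2 V → Bool)) : ℝ :=
  sInf {p | p ∈ Set.Icc (0 : ℝ) 1 ∧ 0 < μ p {ω | G.HasInfiniteCluster ω}}

/-- The balls of radius `R` around `u` in `G` and around `ρ` in `H` are isomorphic as rooted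
graphs. -/
def BallIso {V W : Type*} (G : SimpleGraph V) (u : V) (H : SimpleGraph W) (ρ : W)
    (R : ℕ) : Prop :=
  ∃ φ : (G.induce {w | G.dist u w ≤ R}) ≃g (H.induce {w | H.dist ρ w ≤ R}),
    ((φ ⟨u, by simp [Set.mem_setOf_eq, SimpleGraph.dist_self]⟩ :
        {w | H.dist ρ w ≤ R}) : W) = ρ

/-- The Cheeger constant of the finite graph `G` is at least `h`: every set `A` of at most
half the vertices has at least `h |A|` edges to its complement. -/
def CheegerLB {V : Type*} [Fintype V] (G : SimpleGraph V) (h : ℝ) : Prop :=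
  ∀ A : Set V, A.Nonempty → 2 * A.ncard ≤ Fintype.card V →
    h * A.ncard ≤ ({e | e ∈ G.edgeSet ∧ ∃ a ∈ A, ∃ b ∈ Aᶜ, e = s(a, b)}.ncard : ℝ)

/-- The Bernoulli(`p`) measure on `Bool`. -/
noncomputable def bernoulliBool (p : ℝ) : Measure Bool :=
  ENNReal.ofReal p • Measure.dirac true + ENNReal.ofReal (1 - p) • Measure.dirac false

lemma bernoulliBool_singleton (p : ℝ) (b : Bool) :
    bernoulliBool p {b} = ENNReal.ofReal (if b then p else 1 - p) := by
  cases b <;> simp [bernoulliBool]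

lemma isProbabilityMeasure_bernoulliBool {p : ℝ} (hp : p ∈ Set.Icc (0 : ℝ) 1) :
    IsProbabilityMeasure (bernoulliBool p) := by
  constructor
  have h1 := hp.1
  have h2 := hp.2
  simp only [bernoulliBool, Measure.coe_add, Measure.coe_smul, Pi.add_apply, Pi.smul_apply,
    measure_univ, smul_eq_mul, mul_one]
  rw [← ENNReal.ofReal_add h1 (by linarith)]
  simp

section Config

variable {E E' : Type*}

lemma isBernoulliConfig_pi [Fintype E] {p : ℝ} (hp : p ∈ Set.Icc (0 : ℝ) 1) :
    IsBernoulliConfig p (Measure.pi fun _ : E => bernoulliBool p) := by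
  classical
  have := isProbabilityMeasure_bernoulliBool hp
  refine ⟨inferInstance, fun s f => ?_⟩
  have : {ω : E → Bool | ∀ e ∈ s, ω e = f e} =
      Set.pi Set.univ (fun e => if e ∈ s then {f e} else Set.univ) := by
    ext ω
    simp only [Set.mem_ofPred_eq, Set.mem_pi, Set.mem_univ, true_implies]
    refine forall_congr' fun e => ?_
    by_cases he : e ∈ s <;> simp [he]
  rw [this, Measure.pi_pi, ← Finset.prod_subset (Finset.subset_univ s)]
  · refine Finset.prod_congr rfl fun e he => ?_
    rw [if_pos he, bernoulliBool_singleton]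
  · intro e _ he
    rw [if_neg he, measure_univ]

lemma IsBernoulliConfig.eq [Finite E] {p : ℝ} {μ μ' : Measure (E → Bool)}
    (hμ : IsBernoulliConfig p μ) (hμ' : IsBernoulliConfig p μ') : μ = μ' := by
  have := Fintype.ofFinite E
  refine Measure.ext_of_singleton fun ω => ?_
  have : ({ω} : Set (E → Bool)) = {ω' | ∀ e ∈ Finset.univ, ω' e = ω e} := by
    ext ω'
    simp [funext_iff]
  rw [this, hμ.2, hμ'.2]

lemma IsBernoulliConfig.eq_pi [Fintype E] {p : ℝ} (hp : p ∈ Set.Icc (0 : ℝ) 1)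
    {μ : Measure (E → Bool)} (hμ : IsBernoulliConfig p μ) :
    μ = Measure.pi fun _ : E => bernoulliBool p :=
  hμ.eq (isBernoulliConfig_pi hp)

lemma measurable_comp_config (f : E' → E) :
    Measurable (fun (ω : E → Bool) (e : E') => ω (f e)) :=
  measurable_pi_iff.mpr fun e => measurable_pi_apply (f e)

lemma IsBernoulliConfig.map_comp {p : ℝ} {μ : Measure (E → Bool)}
    (hμ : IsBernoulliConfig p μ) {f : E' → E} (hf : Function.Injective f) :
    IsBernoulliConfig p (μ.map fun ω e => ω (f e)) := by
  classical
  have := hμ.1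
  refine ⟨Measure.isProbabilityMeasure_map (measurable_comp_config f).aemeasurable,
    fun s g => ?_⟩
  have hms : MeasurableSet {ω : E' → Bool | ∀ e ∈ s, ω e = g e} := by
    have : {ω : E' → Bool | ∀ e ∈ s, ω e = g e} = ⋂ e ∈ s, (fun ω => ω e) ⁻¹' {g e} := by
      ext ω; simp
    rw [this]
    exact Finset.measurableSet_biInter s fun e _ =>
      measurable_pi_apply e (measurableSet_singleton _)
  rw [Measure.map_apply (measurable_comp_config f) hms]
  have h2 := hμ.2 (s.image f) (Function.extend f g fun _ => true)
  rw [Finset.prod_image fun _ _ _ _ h => hf h] at h2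
  simp only [hf.extend_apply] at h2
  rw [← h2]
  congr 1
  ext ω
  simp [hf.extend_apply]

lemma IsBernoulliConfig.measure_inter [Finite E] {p : ℝ} (hp : p ∈ Set.Icc (0 : ℝ) 1)
    {μ : Measure (E → Bool)} (hμ : IsBernoulliConfig p μ) {S T : Set (E → Bool)} {s t : Set E}
    (hst : Disjoint s t)
    (hS : ∀ ω ω' : E → Bool, (∀ e ∈ s, ω e = ω' e) → ω ∈ S → ω' ∈ S)
    (hT : ∀ ω ω' : E → Bool, (∀ e ∈ t, ω e = ω' e) → ω ∈ T → ω' ∈ T) :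
    μ (S ∩ T) = μ S * μ T := by
  classical
  have := Fintype.ofFinite E
  have := isProbabilityMeasure_bernoulliBool hp
  have hind : ProbabilityTheory.iIndepFun (fun (e : E) (ω : E → Bool) => ω e) μ := by
    rw [hμ.eq_pi hp]
    exact ProbabilityTheory.iIndepFun_pi (X := fun _ => id) fun _ => aemeasurable_id
  have key := hind.indepFun_finset s.toFinset t.toFinset (by simpa using hst)
    fun e => measurable_pi_apply e
  have hpre : ∀ (u : Set E) (U : Set (E → Bool)),
      (∀ ω ω' : E → Bool, (∀ e ∈ u, ω e = ω' e) → ω ∈ U → ω' ∈ U) →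
      U = (fun ω (e : u.toFinset) => ω e) ⁻¹' ((fun ω (e : u.toFinset) => ω e) '' U) := by
    intro u U hU
    refine Set.Subset.antisymm (Set.subset_preimage_image _ _) ?_
    rintro ω ⟨ω', hω', heq⟩
    refine hU ω' ω (fun e he => ?_) hω'
    exact congrFun heq ⟨e, by simpa using he⟩
  rw [hpre s S hS, hpre t T hT]
  exact key.measure_inter_preimage_eq_mul _ _ (Set.toFinite _).measurableSet
    (Set.toFinite _).measurableSet

/-- The union of independent Bernoulli configurations is a Bernoulli configuration. -/
lemma IsBernoulliConfig.map_or [Finite E] {p q ε : ℝ} (hp : p ∈ Set.Icc (0 : ℝ) 1)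
    (hq : q ∈ Set.Icc (0 : ℝ) 1) (hε : ε ∈ Set.Icc (0 : ℝ) 1)
    (hpq : 1 - p = (1 - q) * (1 - ε)) {μ κ κ' : Measure (E → Bool)}
    (hμ : IsBernoulliConfig p μ) (hκ : IsBernoulliConfig q κ) (hκ' : IsBernoulliConfig ε κ') :
    μ = (κ.prod κ').map fun x e => x.1 e || x.2 e := by
  have := Fintype.ofFinite E
  have := isProbabilityMeasure_bernoulliBool hp
  have := isProbabilityMeasure_bernoulliBool hq
  have := isProbabilityMeasure_bernoulliBool hε
  have hor : bernoulliBool p =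
      ((bernoulliBool q).prod (bernoulliBool ε)).map (fun x => x.1 || x.2) := by
    have hP : IsProbabilityMeasure
        (((bernoulliBool q).prod (bernoulliBool ε)).map (fun x : Bool × Bool => x.1 || x.2)) :=
      Measure.isProbabilityMeasure_map (measurable_of_countable _).aemeasurable
    have hf : bernoulliBool p {false} =
        ((bernoulliBool q).prod (bernoulliBool ε)).map (fun x => x.1 || x.2) {false} := by
      rw [Measure.map_apply (measurable_of_countable _) (measurableSet_singleton _)]
      have : (fun x : Bool × Bool => x.1 || x.2) ⁻¹' {false} = {false} ×ˢ {false} := by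
        ext ⟨a, b⟩; simp
      rw [this, Measure.prod_prod]
      simp only [bernoulliBool_singleton, Bool.false_eq_true, if_false]
      rw [← ENNReal.ofReal_mul (by linarith [hq.2]), hpq]
    refine Measure.ext_of_singleton fun b => ?_
    cases b
    · exact hf
    · have hc : ({true} : Set Bool) = {false}ᶜ := by ext b; simp
      rw [hc, prob_compl_eq_one_sub (measurableSet_singleton _),
        prob_compl_eq_one_sub (measurableSet_singleton _), hf]
  rw [hμ.eq_pi hp, hκ.eq_pi hq, hκ'.eq_pi hε, hor,
    ← (measurePreserving_arrowProdEquivProdArrow Bool Bool E (fun _ => bernoulliBool q)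
      (fun _ => bernoulliBool ε)).map_eq,
    Measure.map_map (measurable_of_countable _) (MeasurableEquiv.measurable _)]
  have : SigmaFinite (((bernoulliBool q).prod (bernoulliBool ε)).map
      (fun x : Bool × Bool => x.1 || x.2)) := by
    rw [← hor]; infer_instance
  rw [← Measure.pi_map_pi fun _ => (measurable_of_countable _).aemeasurable]
  rfl

lemma exists_sprinkling {p q : ℝ} (hqp : q < p) (hp : p ≤ 1) :
    ∃ ε : ℝ, 0 < ε ∧ ε ≤ 1 ∧ 1 - p = (1 - q) * (1 - ε) := by
  have h1 : 0 < 1 - q := by linarith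
  refine ⟨(p - q) / (1 - q), div_pos (by linarith) h1, ?_, ?_⟩
  · rw [div_le_one h1]; linarith
  · field_simp; ring

end Config

section Clusters

variable {V V' : Type*}

namespace SimpleGraph.OpenConn

lemma mono {G : SimpleGraph V} {ω ω' : Sym2 V → Bool} (hω : ∀ e, ω e = true → ω' e = true)
    {a b : V} (hab : G.OpenConn ω a b) : G.OpenConn ω' a b := by
  induction hab with
  | refl => exact Relation.ReflTransGen.refl
  | tail _ h ih => exact ih.tail ⟨h.1, hω _ h.2⟩

lemma symm {G : SimpleGraph V} {ω : Sym2 V → Bool} {a b : V} (hab : G.OpenConn ω a b) :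
    G.OpenConn ω b a := by
  induction hab with
  | refl => exact Relation.ReflTransGen.refl
  | tail _ h ih => exact ih.head ⟨h.1.symm, by rw [Sym2.eq_swap]; exact h.2⟩

lemma trans {G : SimpleGraph V} {ω : Sym2 V → Bool} {a b c : V} (hab : G.OpenConn ω a b)
    (hbc : G.OpenConn ω b c) : G.OpenConn ω a c :=
  Relation.ReflTransGen.trans hab hbc

lemma map {G : SimpleGraph V} {H : SimpleGraph V'} (f : G →g H) {ω : Sym2 V' → Bool} {a b : V}
    (hab : G.OpenConn (fun e => ω (e.map f)) a b) : H.OpenConn ω (f a) (f b) := by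
  induction hab with
  | refl => exact Relation.ReflTransGen.refl
  | tail _ h ih => exact ih.tail ⟨f.map_adj h.1, h.2⟩

end SimpleGraph.OpenConn

/-- The event that the open cluster of `v` has at least `K` vertices. -/
def SimpleGraph.clusterGE (G : SimpleGraph V) (v : V) (K : ℕ) : Set (Sym2 V → Bool) :=
  {ω | K ≤ {w | G.OpenConn ω v w}.ncard}

lemma SimpleGraph.Iso.measure_clusterGE [Finite V] [Finite V'] {G : SimpleGraph V}
    {H : SimpleGraph V'} (φ : G ≃g H) {p : ℝ} {μ : Measure (Sym2 V → Bool)}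
    {μ' : Measure (Sym2 V' → Bool)} (hμ : IsBernoulliConfig p μ) (hμ' : IsBernoulliConfig p μ')
    (v : V) (K : ℕ) : μ (G.clusterGE v K) = μ' (H.clusterGE (φ v) K) := by
  have hinj : Function.Injective (Sym2.map φ) := Sym2.map.injective φ.injective
  rw [hμ.eq (hμ'.map_comp hinj),
    Measure.map_apply (measurable_comp_config _) (Set.toFinite _).measurableSet]
  congr 1
  ext ω
  have : {w | H.OpenConn ω (φ v) w} =
      φ '' {w | G.OpenConn (fun e => ω (e.map φ)) v w} := by
    ext w
    constructor
    · intro hw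
      refine ⟨φ.symm w, ?_, by simp⟩
      have h1 : H.OpenConn (fun e => (fun e' : Sym2 V => ω (e'.map φ)) (e.map φ.symm)) (φ v) w := by
        refine hw.mono fun e he => ?_
        simp only [Sym2.map_map]
        have : (φ ∘ φ.symm : V' → V') = id := by ext x; simp
        rw [this, Sym2.map_id]
        exact he
      have h2 := SimpleGraph.OpenConn.map (ω := fun e' => ω (e'.map φ)) (φ.symm : H →g G) h1
      simpa using h2
    · rintro ⟨x, hx, rfl⟩
      exact SimpleGraph.OpenConn.map (φ : G →g H) hx
  change K ≤ _ ↔ K ≤ {w | H.OpenConn ω (φ v) w}.ncard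
  rw [this, Set.ncard_image_of_injective _ φ.injective]

end Clusters

section InfiniteGraph

variable {W : Type*} {G : SimpleGraph W} {ρ : W}

lemma SimpleGraph.Connected.exists_openConn_dist_eq (hG : G.Connected)
    (hfin : ∀ R, {w | G.dist ρ w ≤ R}.Finite) {v : W} {ω : Sym2 W → Bool}
    (hinf : {w | G.OpenConn ω v w}.Infinite) {R : ℕ} (hv : G.dist ρ v ≤ R) :
    ∃ w : {w | G.dist ρ w ≤ R}, G.dist ρ w = R ∧
      (G.induce {w | G.dist ρ w ≤ R}).OpenConn (fun e => ω (e.map (↑))) ⟨v, hv⟩ w := by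
  by_contra! hcon
  refine hinf ((hfin R).subset ?_)
  have key : ∀ w, G.OpenConn ω v w → ∃ hw : G.dist ρ w ≤ R,
      (G.induce {w | G.dist ρ w ≤ R}).OpenConn (fun e => ω (e.map (↑))) ⟨v, hv⟩ ⟨w, hw⟩ := by
    intro w hw
    induction hw with
    | refl => exact ⟨hv, Relation.ReflTransGen.refl⟩
    | @tail b c _ hbc ih =>
      obtain ⟨hb, hvb⟩ := ih
      have hne : G.dist ρ b ≠ R := fun h => hcon ⟨b, hb⟩ h hvb
      have h1 : G.dist ρ c ≤ G.dist ρ b + G.dist b c := hG.dist_triangle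
      rw [SimpleGraph.dist_eq_one_iff_adj.mpr hbc.1] at h1
      have hc : G.dist ρ c ≤ R := by omega
      exact ⟨hc, hvb.tail ⟨hbc.1, by simpa using hbc.2⟩⟩
  exact fun w hw => (key w hw).1

lemma SimpleGraph.Connected.clusterGE_of_infinite (hG : G.Connected)
    (hfin : ∀ R, {w | G.dist ρ w ≤ R}.Finite) {v : W} {ω : Sym2 W → Bool}
    (hinf : {w | G.OpenConn ω v w}.Infinite) {R K : ℕ} (hR : G.dist ρ v + K ≤ R) :
    (fun e => ω (e.map (↑))) ∈
      (G.induce {w | G.dist ρ w ≤ R}).clusterGE ⟨v, (Nat.le_add_right _ _).trans hR⟩ K := by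
  have : Finite {w | G.dist ρ w ≤ R} := hfin R
  have hex : ∀ i : ℕ, ∃ w : {w | G.dist ρ w ≤ R}, i < K → (G.dist ρ w = G.dist ρ v + i ∧
      (G.induce {w | G.dist ρ w ≤ R}).OpenConn (fun e => ω (e.map (↑)))
        ⟨v, (Nat.le_add_right _ _).trans hR⟩ w) := by
    intro i
    by_cases hi : i < K
    · obtain ⟨w, hw, hvw⟩ := hG.exists_openConn_dist_eq hfin hinf
        (R := G.dist ρ v + i) (Nat.le_add_right _ _)
      have hle : {w | G.dist ρ w ≤ G.dist ρ v + i} ≤ {w | G.dist ρ w ≤ R} := by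
        intro x (hx : G.dist ρ x ≤ _)
        change G.dist ρ x ≤ R
        omega
      refine ⟨⟨w, hle w.2⟩, fun _ => ⟨hw, ?_⟩⟩
      refine SimpleGraph.OpenConn.map (G.induceHomOfLE hle).toHom
        (ω := fun e => ω (e.map (↑))) (a := ⟨v, _⟩) (b := w) (hvw.mono fun e he => ?_)
      rw [Sym2.map_map]
      exact he
    · exact ⟨⟨v, (Nat.le_add_right _ _).trans hR⟩, fun h => absurd h hi⟩
  choose f hf using hex
  refine Set.le_ncard_of_inj_on_range f (fun i hi => (hf i hi).2) fun i hi j hj hij => ?_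
  have h1 := (hf i hi).1
  rw [hij, (hf j hj).1] at h1
  omega

lemma SimpleGraph.Reachable.exists_finset_openConn {v : W} (hv : G.Reachable ρ v) :
    ∃ (γ : Finset (Sym2 W)) (R₀ : ℕ), ∀ R ≥ R₀, ∃ hv : G.dist ρ v ≤ R,
      ∀ ω : Sym2 {w | G.dist ρ w ≤ R} → Bool, (∀ e, e.map (↑) ∈ γ → ω e = true) →
      (G.induce {w | G.dist ρ w ≤ R}).OpenConn ω ⟨ρ, by simp⟩ ⟨v, hv⟩ := by
  classical
  rw [SimpleGraph.reachable_iff_reflTransGen] at hv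
  induction hv with
  | refl => exact ⟨∅, 0, fun R _ => ⟨by simp, fun ω _ => Relation.ReflTransGen.refl⟩⟩
  | @tail b c _ hbc ih =>
    obtain ⟨γ, R₀, h⟩ := ih
    refine ⟨insert s(b, c) γ, max R₀ (G.dist ρ c), fun R hR => ?_⟩
    obtain ⟨hb, h⟩ := h R (le_of_max_le_left hR)
    refine ⟨le_of_max_le_right hR, fun ω hω => ?_⟩
    refine (h ω fun e he => hω e (Finset.mem_insert_of_mem he)).trans
      (Relation.ReflTransGen.single ⟨hbc, hω _ ?_⟩)
    simp

/-- If `q < q'` and Bernoulli(`q`) percolation has an infinite cluster with positive probability,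
then the cluster of `ρ` in Bernoulli(`q'`) percolation inside large balls around `ρ` reaches any
given size with probability bounded below. -/
lemma exists_le_measure_clusterGE (hG : G.Connected)
    (hfin : ∀ R, {w | G.dist ρ w ≤ R}.Finite) {q q' : ℝ} (hq : q ∈ Set.Icc (0 : ℝ) 1)
    (hq' : q' ∈ Set.Icc (0 : ℝ) 1) (hqq : q < q') {μ : Measure (Sym2 W → Bool)}
    (hμ : IsBernoulliConfig q μ) (hinf : 0 < μ {ω | G.HasInfiniteCluster ω}) :
    ∃ θ : ℝ, 0 < θ ∧ ∀ K : ℕ, ∃ R : ℕ,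
      ∀ κ : Measure (Sym2 {w | G.dist ρ w ≤ R} → Bool), IsBernoulliConfig q' κ →
        ENNReal.ofReal θ ≤
          κ ((G.induce {w | G.dist ρ w ≤ R}).clusterGE ⟨ρ, by simp⟩ K) := by
  classical
  have := hμ.1
  have hcount : Countable W := by
    have huniv : (Set.univ : Set W) = ⋃ R, {w | G.dist ρ w ≤ R} := by
      ext w
      simp only [Set.mem_univ, Set.mem_iUnion, true_iff]
      exact ⟨G.dist ρ w, le_refl (G.dist ρ w)⟩
    rw [← Set.countable_univ_iff, huniv]
    exact Set.countable_iUnion fun R => (hfin R).countable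
  obtain ⟨v, hv⟩ : ∃ v, 0 < μ {ω | {w | G.OpenConn ω v w}.Infinite} := by
    by_contra! hcon
    refine hinf.ne' ?_
    have : {ω | G.HasInfiniteCluster ω} = ⋃ v, {ω | {w | G.OpenConn ω v w}.Infinite} := by
      ext ω
      simp [SimpleGraph.HasInfiniteCluster]
    rw [this]
    exact measure_iUnion_null fun v => le_antisymm (hcon v) zero_le
  obtain ⟨γ, R₀, hγ⟩ := (hG.preconnected ρ v).exists_finset_openConn
  obtain ⟨ε, hε0, hε1, hε⟩ := exists_sprinkling hqq hq'.2
  set c := (μ {ω | {w | G.OpenConn ω v w}.Infinite}).toReal with hc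
  have hc0 : 0 < c := ENNReal.toReal_pos hv.ne' (measure_ne_top _ _)
  refine ⟨c * ε ^ γ.card, by positivity, fun K => ?_⟩
  obtain ⟨R, hR₀, hRK⟩ : ∃ R, R₀ ≤ R ∧ G.dist ρ v + K ≤ R := ⟨_, le_max_left _ _, le_max_right _ _⟩
  refine ⟨R, fun κ hκ => ?_⟩
  have hfinB : Finite {w | G.dist ρ w ≤ R} := hfin R
  have hftB : Fintype {w | G.dist ρ w ≤ R} := Fintype.ofFinite _
  obtain ⟨hvR, hγ⟩ := hγ R hR₀
  have hval : Function.Injective (Sym2.map ((↑) : {w | G.dist ρ w ≤ R} → W)) :=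
    Sym2.map.injective Subtype.val_injective
  have hκq := hμ.map_comp hval
  have hεI : ε ∈ Set.Icc (0 : ℝ) 1 := ⟨hε0.le, hε1⟩
  have hκε := isBernoulliConfig_pi (E := Sym2 {w | G.dist ρ w ≤ R}) hεI
  set s : Finset (Sym2 {w | G.dist ρ w ≤ R}) :=
    Finset.univ.filter fun e => e.map (↑) ∈ γ with hs
  have hscard : s.card ≤ γ.card :=
    Finset.card_le_card_of_injOn (Sym2.map (↑)) (fun e he => by simpa [hs] using he) hval.injOn
  have h1 : ENNReal.ofReal c ≤ μ.map (fun ω e => ω (e.map (↑)))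
      ((G.induce {w | G.dist ρ w ≤ R}).clusterGE ⟨v, hvR⟩ K) := by
    rw [hc, ENNReal.ofReal_toReal (measure_ne_top _ _),
      Measure.map_apply (measurable_comp_config _) (Set.toFinite _).measurableSet]
    exact measure_mono fun ω hω => hG.clusterGE_of_infinite hfin hω hRK
  have h2 : ENNReal.ofReal ε ^ γ.card ≤
      (Measure.pi fun _ : Sym2 {w | G.dist ρ w ≤ R} => bernoulliBool ε)
        {ω | ∀ e ∈ s, ω e = true} := by
    rw [hκε.2 s fun _ => true]
    simp only [if_true, Finset.prod_const]
    exact pow_le_pow_of_le_one zero_le (by simpa using hε1) hscard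
  have := hκq.1
  have := hκε.1
  rw [hκ.map_or hq' hq hεI hε hκq hκε, Measure.map_apply (measurable_of_countable _)
    (Set.toFinite _).measurableSet, ENNReal.ofReal_mul hc0.le, ENNReal.ofReal_pow hε0.le]
  refine (mul_le_mul' h1 h2).trans ?_
  rw [← Measure.prod_prod]
  refine measure_mono ?_
  rintro ⟨a, b⟩ ⟨ha, hb⟩
  refine le_trans (show K ≤ _ from ha) (Set.ncard_le_ncard ?_ (Set.toFinite _))
  intro w hw
  refine SimpleGraph.OpenConn.trans (hγ _ fun e he => ?_) (SimpleGraph.OpenConn.mono ?_ hw)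
  · have hbe : b e = true := hb e (by simpa [hs] using he)
    simp [hbe]
  · intro e (he : a e = true)
    simp [he]

end InfiniteGraph

/-- Chebyshev's inequality for the number of events of a finite-range dependent family that
occur. -/
lemma IsBernoulliConfig.measure_card_lt_le {E ι : Type*} [Finite E] {p : ℝ}
    (hp : p ∈ Set.Icc (0 : ℝ) 1) {μ : Measure (E → Bool)} (hμ : IsBernoulliConfig p μ)
    (A : ι → Set (E → Bool)) (s : ι → Set E)
    (hA : ∀ v, ∀ ω ω' : E → Bool, (∀ e ∈ s v, ω e = ω' e) → ω ∈ A v → ω' ∈ A v)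
    (I : Finset ι) (hI : I.Nonempty) {θ : ℝ} (hθ : 0 < θ) (hAθ : ∀ v ∈ I, θ ≤ μ.real (A v))
    (D : ℕ) (hD : ∀ v ∈ I, {w | w ∈ I ∧ ¬ Disjoint (s v) (s w)}.ncard ≤ D) :
    μ {ω | ({v | v ∈ I ∧ ω ∈ A v}.ncard : ℝ) < θ * I.card / 2} ≤
      ENNReal.ofReal (4 * D / (θ ^ 2 * I.card)) := by
  classical
  have := Fintype.ofFinite E
  have := hμ.1
  have hmeas : ∀ S : Set (E → Bool), MeasurableSet S := fun S => S.toFinite.measurableSet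
  let X : ι → (E → Bool) → ℝ := fun v => (A v).indicator 1
  have hXm : ∀ v ∈ I, MemLp (X v) 2 μ := fun v _ =>
    memLp_indicator_const (E := ℝ) 2 (hmeas _) 1 (Or.inr (measure_ne_top _ _))
  have hintegral : ∀ S : Set (E → Bool), ∫ ω, S.indicator (1 : (E → Bool) → ℝ) ω ∂μ = μ.real S :=
    fun S => integral_indicator_one (hmeas S)
  have hcov : ∀ v ∈ I, ∀ w ∈ I, ProbabilityTheory.covariance (X v) (X w) μ ≤
      if Disjoint (s v) (s w) then 0 else 1 := by
    intro v hv w hw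
    rw [ProbabilityTheory.covariance_eq_sub (hXm v hv) (hXm w hw)]
    have h1 : X v * X w = (A v ∩ A w).indicator 1 := by
      rw [Set.inter_indicator_one]
    rw [h1, hintegral, hintegral, hintegral]
    split_ifs with hd
    · rw [Measure.real, hμ.measure_inter hp hd (hA v) (hA w), ENNReal.toReal_mul]
      simp [Measure.real]
    · have h2 : μ.real (A v ∩ A w) ≤ 1 := measureReal_le_one
      have h3 : 0 ≤ μ.real (A v) * μ.real (A w) := by positivity
      linarith
  have hvar : ProbabilityTheory.variance (∑ v ∈ I, X v) μ ≤ D * I.card := by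
    rw [ProbabilityTheory.variance_sum' hXm]
    calc _ ≤ ∑ v ∈ I, ∑ w ∈ I, (if Disjoint (s v) (s w) then (0 : ℝ) else 1) :=
          Finset.sum_le_sum fun v hv => Finset.sum_le_sum fun w hw => hcov v hv w hw
      _ ≤ ∑ v ∈ I, (D : ℝ) := by
          refine Finset.sum_le_sum fun v hv => ?_
          have h1 := hD v hv
          have h2 : {w | w ∈ I ∧ ¬ Disjoint (s v) (s w)} =
              ((I.filter fun w => ¬ Disjoint (s v) (s w) : Finset ι) : Set ι) := by
            ext w; simp
          rw [h2, Set.ncard_coe_finset] at h1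
          rw [Finset.sum_ite, Finset.sum_const_zero, zero_add, Finset.sum_const, nsmul_eq_mul,
            mul_one]
          exact_mod_cast h1
      _ = D * I.card := by rw [Finset.sum_const, nsmul_eq_mul, mul_comm]
  have hI0 : (0 : ℝ) < I.card := by exact_mod_cast hI.card_pos
  have hexp : θ * I.card ≤ ∫ ω, (∑ v ∈ I, X v) ω ∂μ := by
    simp only [Finset.sum_apply]
    rw [integral_finsetSum I fun v hv => (hXm v hv).integrable (by norm_num)]
    calc θ * I.card = ∑ v ∈ I, θ := by rw [Finset.sum_const, nsmul_eq_mul, mul_comm]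
      _ ≤ _ := Finset.sum_le_sum fun v hv => (hAθ v hv).trans (hintegral (A v)).ge
  have hcheb := ProbabilityTheory.meas_ge_le_variance_div_sq (memLp_finsetSum' I hXm)
    (show 0 < θ * I.card / 2 by positivity)
  refine (measure_mono ?_).trans (hcheb.trans (ENNReal.ofReal_le_ofReal ?_))
  · intro ω hω
    have hω' : ({v | v ∈ I ∧ ω ∈ A v}.ncard : ℝ) < θ * I.card / 2 := hω
    have hsum : (∑ v ∈ I, X v) ω = ({v | v ∈ I ∧ ω ∈ A v}.ncard : ℝ) := by
      have h2 : {v | v ∈ I ∧ ω ∈ A v} = ((I.filter fun v => ω ∈ A v : Finset ι) : Set ι) := by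
        ext w; simp
      rw [h2, Set.ncard_coe_finset, Finset.sum_apply]
      simp [X, Set.indicator_apply]
    change θ * I.card / 2 ≤ |(∑ v ∈ I, X v) ω - ∫ ω, (∑ v ∈ I, X v) ω ∂μ|
    rw [hsum, abs_sub_comm]
    exact le_trans (by linarith) (le_abs_self _)
  · calc _ ≤ (D * I.card : ℝ) / (θ * I.card / 2) ^ 2 := by gcongr
      _ = _ := by field_simp; ring

section FiniteGraph

variable {V : Type*} [Fintype V] {G : SimpleGraph V}

lemma CheegerLB.connected [Nonempty V] {h : ℝ} (hpos : 0 < h) (hG : CheegerLB G h) :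
    G.Connected := by
  classical
  by_contra hcon
  have hpre : ¬ G.Preconnected := fun hp => hcon ⟨hp⟩
  rw [SimpleGraph.Preconnected] at hpre
  push Not at hpre
  obtain ⟨u, v, huv⟩ := hpre
  have key : ∀ A : Set V, A.Nonempty → (∀ a ∈ A, ∀ b, G.Adj a b → b ∈ A) →
      Fintype.card V < 2 * A.ncard := by
    intro A hA hcl
    by_contra! hle
    have h1 := hG A hA hle
    have h2 : {e | e ∈ G.edgeSet ∧ ∃ a ∈ A, ∃ b ∈ Aᶜ, e = s(a, b)} = ∅ := by
      ext e
      simp only [Set.mem_ofPred_eq, Set.mem_empty_iff_false, iff_false]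
      rintro ⟨he, a, ha, b, hb, rfl⟩
      exact hb (hcl a ha b he)
    rw [h2, Set.ncard_empty] at h1
    have h3 : (0 : ℝ) < A.ncard := by
      exact_mod_cast (Set.ncard_pos (Set.toFinite _)).mpr hA
    have := mul_pos hpos h3
    simp at h1
    linarith
  have hu := key {w | G.Reachable u w} ⟨u, SimpleGraph.Reachable.refl u⟩
    fun a ha b hab => SimpleGraph.Reachable.trans ha hab.reachable
  have hv := key {w | G.Reachable v w} ⟨v, SimpleGraph.Reachable.refl v⟩
    fun a ha b hab => SimpleGraph.Reachable.trans ha hab.reachable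
  have hdis : Disjoint {w | G.Reachable u w} {w | G.Reachable v w} := by
    rw [Set.disjoint_left]
    exact fun w hw hw' => huv (SimpleGraph.Reachable.trans hw (SimpleGraph.Reachable.symm hw'))
  have hun := Set.ncard_union_eq hdis (Set.toFinite _) (Set.toFinite _)
  have hle := Set.ncard_le_ncard (Set.subset_univ ({w | G.Reachable u w} ∪ {w | G.Reachable v w}))
  rw [Set.ncard_univ, Nat.card_eq_fintype_card] at hle
  omega

lemma SimpleGraph.Connected.ncard_ball_le (hG : G.Connected) {d : ℕ}
    (hd : ∀ v, (G.neighborSet v).ncard ≤ d) (u : V) (R : ℕ) :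
    {w | G.dist u w ≤ R}.ncard ≤ (d + 1) ^ R := by
  classical
  induction R with
  | zero =>
    have : {w | G.dist u w ≤ 0} = {u} := by
      ext w
      simp only [nonpos_iff_eq_zero, Set.mem_ofPred_eq, Set.mem_singleton_iff]
      rw [hG.dist_eq_zero_iff, eq_comm]
    rw [this]
    simp
  | succ R ih =>
    have hsub : {w | G.dist u w ≤ R + 1} ⊆
        ⋃ x ∈ {w | G.dist u w ≤ R}.toFinset, insert x (G.neighborSet x) := by
      intro w hw
      have hw' : G.dist u w ≤ R + 1 := hw
      simp only [Set.mem_iUnion, Set.mem_toFinset, Set.mem_insert_iff, exists_prop]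
      by_cases hle : G.dist u w ≤ R
      · exact ⟨w, hle, Or.inl rfl⟩
      · have hdist : G.dist w u = R + 1 := by rw [SimpleGraph.dist_comm]; omega
        obtain ⟨W, hW⟩ := hG.exists_walk_length_eq_dist w u
        cases W with
        | nil => simp at hdist
        | @cons _ x _ hwx W' =>
          refine ⟨x, ?_, Or.inr hwx.symm⟩
          have h1 : G.dist x u ≤ W'.length := SimpleGraph.dist_le W'
          rw [SimpleGraph.Walk.length_cons] at hW
          change G.dist u x ≤ R
          rw [SimpleGraph.dist_comm]
          omega
    calc {w | G.dist u w ≤ R + 1}.ncard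
        ≤ (⋃ x ∈ {w | G.dist u w ≤ R}.toFinset, insert x (G.neighborSet x)).ncard :=
          Set.ncard_le_ncard hsub (Set.toFinite _)
      _ ≤ ∑ x ∈ {w | G.dist u w ≤ R}.toFinset, (insert x (G.neighborSet x)).ncard :=
          Finset.set_ncard_biUnion_le _ _
      _ ≤ ∑ x ∈ {w | G.dist u w ≤ R}.toFinset, (d + 1) :=
          Finset.sum_le_sum fun x _ => (Set.ncard_insert_le _ _).trans (by
            have := hd x; omega)
      _ ≤ (d + 1) ^ (R + 1) := by
          rw [Finset.sum_const, ← Set.ncard_eq_toFinset_card', smul_eq_mul, pow_succ]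
          gcongr

/-- Many vertices have a large cluster, with high probability. -/
lemma SimpleGraph.Connected.measure_card_large_lt_le (hG : G.Connected) {d : ℕ}
    (hd : ∀ v, (G.neighborSet v).ncard ≤ d) {p : ℝ} (hp : p ∈ Set.Icc (0 : ℝ) 1)
    {μ : Measure (Sym2 V → Bool)} (hμ : IsBernoulliConfig p μ) {W : Type*} {H : SimpleGraph W}
    {ρ : W} {R K : ℕ} {θ : ℝ} (hθ : 0 < θ)
    (hH : ∀ κ : Measure (Sym2 {w | H.dist ρ w ≤ R} → Bool), IsBernoulliConfig p κ →
        ENNReal.ofReal θ ≤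
          κ ((H.induce {w | H.dist ρ w ≤ R}).clusterGE ⟨ρ, by simp⟩ K))
    (hI : {v | BallIso G v H ρ R}.Nonempty) :
    μ {ω | ({v | ω ∈ G.clusterGE v K}.ncard : ℝ) < θ * {v | BallIso G v H ρ R}.ncard / 2} ≤
      ENNReal.ofReal (4 * ((d + 1) ^ (2 * R) : ℕ) / (θ ^ 2 * {v | BallIso G v H ρ R}.ncard)) := by
  classical
  have := hμ.1
  set I : Finset V := {v | BallIso G v H ρ R}.toFinset with hIdef
  have hIcard : {v | BallIso G v H ρ R}.ncard = I.card := Set.ncard_eq_toFinset_card' _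
  rw [hIcard]
  let A : V → Set (Sym2 V → Bool) := fun v =>
    (fun ω e => ω (e.map (↑))) ⁻¹' ((G.induce {w | G.dist v w ≤ R}).clusterGE ⟨v, by simp⟩ K)
  have hinj : ∀ v, Function.Injective (Sym2.map ((↑) : {w | G.dist v w ≤ R} → V)) :=
    fun v => Sym2.map.injective Subtype.val_injective
  have hAsub : ∀ v, A v ⊆ G.clusterGE v K := by
    intro v ω hω
    have hω' : K ≤ {w | (G.induce {w | G.dist v w ≤ R}).OpenConn
      (fun e => ω (e.map (↑))) ⟨v, by simp⟩ w}.ncard := hω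
    refine hω'.trans ?_
    rw [← Set.ncard_image_of_injective _ Subtype.val_injective]
    refine Set.ncard_le_ncard ?_ (Set.toFinite _)
    rintro _ ⟨w, hw, rfl⟩
    exact SimpleGraph.OpenConn.map (SimpleGraph.Embedding.induce _).toHom hw
  have key := hμ.measure_card_lt_le hp A
    (fun v => Set.range (Sym2.map ((↑) : {w | G.dist v w ≤ R} → V))) ?_ I (Set.toFinset_nonempty.mpr hI)
    hθ ?_ ((d + 1) ^ (2 * R)) ?_
  · refine (measure_mono ?_).trans key
    intro ω hω
    refine lt_of_le_of_lt ?_ (show ({v | ω ∈ G.clusterGE v K}.ncard : ℝ) < _ from hω)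
    exact_mod_cast Set.ncard_le_ncard (fun v (hv : v ∈ I ∧ ω ∈ A v) => hAsub v hv.2) (Set.toFinite _)
  · intro v ω ω' hωω' hω
    have : (fun e : Sym2 {w | G.dist v w ≤ R} => ω (e.map (↑))) = fun e => ω' (e.map (↑)) :=
      funext fun e => hωω' _ ⟨e, rfl⟩
    change (fun e : Sym2 {w | G.dist v w ≤ R} => ω' (e.map (↑))) ∈
      (G.induce {w | G.dist v w ≤ R}).clusterGE ⟨v, by simp⟩ K
    rw [← this]
    exact hω
  · intro v hv
    obtain ⟨φ, hφ⟩ : BallIso G v H ρ R := by simpa [hIdef] using hv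
    have hfinH : Finite {w | H.dist ρ w ≤ R} := Finite.of_equiv _ φ.toEquiv
    have hft : Fintype {w | H.dist ρ w ≤ R} := Fintype.ofFinite _
    have hκ := isBernoulliConfig_pi (E := Sym2 {w | H.dist ρ w ≤ R}) hp
    have h1 := hH _ hκ
    have h2 := φ.measure_clusterGE (hμ.map_comp (hinj v)) hκ ⟨v, by simp⟩ K
    have h3 : φ ⟨v, by simp⟩ = ⟨ρ, by simp⟩ := Subtype.ext hφ
    rw [h3] at h2
    rw [← h2, Measure.map_apply (measurable_comp_config _) (Set.toFinite _).measurableSet] at h1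
    exact (ENNReal.ofReal_le_iff_le_toReal (measure_ne_top _ _)).mp h1
  · intro v hv
    refine le_trans (Set.ncard_le_ncard ?_ (Set.toFinite _)) (hG.ncard_ball_le hd v (2 * R))
    rintro w ⟨-, hw⟩
    rw [Set.not_disjoint_iff] at hw
    obtain ⟨e, ⟨e₁, rfl⟩, e₂, he⟩ := hw
    induction e₁ with
    | h x y =>
      have hx : (x : V) ∈ Sym2.map (↑) e₂ := by
        rw [he]; simp
      rw [Sym2.mem_map] at hx
      obtain ⟨z, -, hz⟩ := hx
      have h1 : G.dist v x ≤ R := x.2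
      have h2 : G.dist w z ≤ R := z.2
      have h3 : G.dist v w ≤ G.dist v x + G.dist x w := hG.dist_triangle
      rw [hz, SimpleGraph.dist_comm] at h2
      change G.dist v w ≤ 2 * R
      omega

end FiniteGraph

section Expander

variable {V : Type*} {G : SimpleGraph V}

/-- The vertices that can be joined to `A` by a path of length at most `i` avoiding `F`. -/
def SimpleGraph.reachSet (G : SimpleGraph V) (A : Set V) (F : Finset (Sym2 V)) (i : ℕ) : Set V :=
  {v | ∃ γ : Finset (Sym2 V), Disjoint γ F ∧ γ.card ≤ i ∧
    ∃ x ∈ A, ∀ ω : Sym2 V → Bool, (∀ e ∈ γ, ω e = true) → G.OpenConn ω x v}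

lemma SimpleGraph.subset_reachSet (A : Set V) (F : Finset (Sym2 V)) (i : ℕ) :
    A ⊆ G.reachSet A F i :=
  fun x hx => ⟨∅, by simp, by simp, x, hx, fun _ _ => Relation.ReflTransGen.refl⟩

lemma SimpleGraph.reachSet_subset_succ (A : Set V) (F : Finset (Sym2 V)) (i : ℕ) :
    G.reachSet A F i ⊆ G.reachSet A F (i + 1) :=
  fun _ ⟨γ, h1, h2, h3⟩ => ⟨γ, h1, h2.trans (Nat.le_succ i), h3⟩

lemma SimpleGraph.mem_reachSet_succ {A : Set V} {F : Finset (Sym2 V)} {i : ℕ} {a b : V}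
    (ha : a ∈ G.reachSet A F i) (hab : G.Adj a b) (hF : s(a, b) ∉ F) :
    b ∈ G.reachSet A F (i + 1) := by
  classical
  obtain ⟨γ, h1, h2, x, hx, h3⟩ := ha
  refine ⟨insert s(a, b) γ, ?_, ?_, x, hx, fun ω hω => ?_⟩
  · rw [Finset.disjoint_insert_left]
    exact ⟨hF, h1⟩
  · exact (Finset.card_insert_le _ _).trans (by omega)
  · exact (h3 ω fun e he => hω e (Finset.mem_insert_of_mem he)).tail
      ⟨hab, hω _ (Finset.mem_insert_self _ _)⟩

variable [Fintype V]

lemma CheegerLB.reachSet_succ {h : ℝ} (hG : CheegerLB G h) {d : ℕ}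
    (hd : ∀ v, (G.neighborSet v).ncard ≤ d) {A : Set V} (hA : A.Nonempty) (F : Finset (Sym2 V))
    (i : ℕ) (hi : 2 * (G.reachSet A F i).ncard ≤ Fintype.card V) :
    h * (G.reachSet A F i).ncard ≤
      F.card + d * ((G.reachSet A F (i + 1)).ncard - (G.reachSet A F i).ncard : ℝ) := by
  classical
  have h1 := hG _ (hA.mono (SimpleGraph.subset_reachSet A F i)) hi
  refine h1.trans ?_
  set S := G.reachSet A F i
  set T := G.reachSet A F (i + 1)
  have hST : S ⊆ T := SimpleGraph.reachSet_subset_succ A F i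
  have hsub : {e | e ∈ G.edgeSet ∧ ∃ a ∈ S, ∃ b ∈ Sᶜ, e = s(a, b)} ⊆
      (F : Set (Sym2 V)) ∪ ⋃ b ∈ (T \ S).toFinset, (fun a => s(a, b)) '' G.neighborSet b := by
    rintro e ⟨he, a, ha, b, hb, rfl⟩
    by_cases hF : s(a, b) ∈ F
    · exact Or.inl hF
    · right
      simp only [Set.mem_iUnion, Set.mem_toFinset, exists_prop]
      exact ⟨b, ⟨SimpleGraph.mem_reachSet_succ ha he hF, hb⟩, a, SimpleGraph.Adj.symm he, rfl⟩
  have h2 : {e | e ∈ G.edgeSet ∧ ∃ a ∈ S, ∃ b ∈ Sᶜ, e = s(a, b)}.ncard ≤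
      F.card + (T \ S).ncard * d := by
    refine (Set.ncard_le_ncard hsub (Set.toFinite _)).trans ((Set.ncard_union_le _ _).trans ?_)
    rw [Set.ncard_coe_finset]
    refine Nat.add_le_add_left ((Finset.set_ncard_biUnion_le _ _).trans ?_) _
    rw [Set.ncard_eq_toFinset_card' (T \ S), ← smul_eq_mul]
    exact Finset.sum_le_card_nsmul _ _ _ fun b _ =>
      (Set.ncard_image_le (Set.toFinite _)).trans (hd b)
  have h3 : (T \ S).ncard + S.ncard = T.ncard := Set.ncard_sdiff_add_ncard_of_subset hST
  have h4 : ((T \ S).ncard : ℝ) = T.ncard - S.ncard := by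
    rw [← h3]; push_cast; ring
  rw [← h4]
  have h5 : ({e | e ∈ G.edgeSet ∧ ∃ a ∈ S, ∃ b ∈ Sᶜ, e = s(a, b)}.ncard : ℝ) ≤
      F.card + (T \ S).ncard * d := by exact_mod_cast h2
  linarith

lemma CheegerLB.lt_ncard_reachSet {h : ℝ} (hpos : 0 < h) (hG : CheegerLB G h) {d : ℕ}
    (hd0 : 0 < d) (hd : ∀ v, (G.neighborSet v).ncard ≤ d) {A : Set V} {x : ℝ} (hx : 0 < x)
    (hA : x ≤ A.ncard) {F : Finset (Sym2 V)} (hF : F.card ≤ h * x / 2) {t : ℕ}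
    (ht : d * Fintype.card V ≤ t * (h * x)) :
    Fintype.card V < 2 * (G.reachSet A F t).ncard := by
  have hA0 : A.Nonempty := by
    rw [← Set.ncard_pos (Set.toFinite _)]
    exact_mod_cast hx.trans_le hA
  have hd0' : (0 : ℝ) < d := by exact_mod_cast hd0
  have key : ∀ i, Fintype.card V < 2 * (G.reachSet A F i).ncard ∨
      d * x + i * (h * x / 2) ≤ d * (G.reachSet A F i).ncard := by
    intro i
    induction i with
    | zero =>
      right
      have h1 : (A.ncard : ℝ) ≤ (G.reachSet A F 0).ncard := by
        exact_mod_cast Set.ncard_le_ncard (SimpleGraph.subset_reachSet A F 0) (Set.toFinite _)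
      have := mul_le_mul_of_nonneg_left (hA.trans h1) hd0'.le
      simpa using this
    | succ i ih =>
      have hmono := Set.ncard_le_ncard (SimpleGraph.reachSet_subset_succ (G := G) A F i)
        (Set.toFinite _)
      rcases ih with ih | ih
      · left; omega
      · by_cases hi : 2 * (G.reachSet A F i).ncard ≤ Fintype.card V
        · right
          have h1 := hG.reachSet_succ hd hA0 F i hi
          have h2 : (A.ncard : ℝ) ≤ (G.reachSet A F i).ncard := by
            exact_mod_cast Set.ncard_le_ncard (SimpleGraph.subset_reachSet A F i) (Set.toFinite _)
          have h3 := mul_le_mul_of_nonneg_left (hA.trans h2) hpos.le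
          push_cast
          linarith
        · left; omega
  rcases key t with h1 | h1
  · exact h1
  · have h2 : (d : ℝ) * Fintype.card V < d * (2 * (G.reachSet A F t).ncard) := by
      have := mul_pos hd0' hx
      linarith
    exact_mod_cast lt_of_mul_lt_mul_left h2 hd0'.le

lemma CheegerLB.exists_short_path {h : ℝ} (hpos : 0 < h) (hG : CheegerLB G h) {d : ℕ}
    (hd0 : 0 < d) (hd : ∀ v, (G.neighborSet v).ncard ≤ d) {A B : Set V} {x : ℝ} (hx : 0 < x)
    (hA : x ≤ A.ncard) (hB : x ≤ B.ncard) {F : Finset (Sym2 V)} (hF : F.card ≤ h * x / 2) {t : ℕ}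
    (ht : d * Fintype.card V ≤ t * (h * x)) :
    ∃ γ : Finset (Sym2 V), Disjoint γ F ∧ γ.card ≤ 2 * t ∧
      ∃ a ∈ A, ∃ b ∈ B, ∀ ω : Sym2 V → Bool, (∀ e ∈ γ, ω e = true) → G.OpenConn ω a b := by
  classical
  have h1 := hG.lt_ncard_reachSet hpos hd0 hd hx hA hF ht
  have h2 := hG.lt_ncard_reachSet hpos hd0 hd hx hB hF ht
  obtain ⟨v, ⟨γ₁, hγ₁, hc₁, a, ha, hav⟩, ⟨γ₂, hγ₂, hc₂, b, hb, hbv⟩⟩ :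
      (G.reachSet A F t ∩ G.reachSet B F t).Nonempty := by
    by_contra hemp
    have hdis : Disjoint (G.reachSet A F t) (G.reachSet B F t) :=
      Set.disjoint_iff_inter_eq_empty.mpr (Set.not_nonempty_iff_eq_empty.mp hemp)
    have hun := Set.ncard_union_eq hdis (Set.toFinite _) (Set.toFinite _)
    have hle := Set.ncard_le_ncard (Set.subset_univ (G.reachSet A F t ∪ G.reachSet B F t))
    rw [Set.ncard_univ, Nat.card_eq_fintype_card] at hle
    omega
  refine ⟨γ₁ ∪ γ₂, ?_, (Finset.card_union_le _ _).trans (by omega), a, ha, b, hb, fun ω hω => ?_⟩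
  · rw [Finset.disjoint_union_left]
    exact ⟨hγ₁, hγ₂⟩
  · exact (hav ω fun e he => hω e (Finset.mem_union_left _ he)).trans
      (hbv ω fun e he => hω e (Finset.mem_union_right _ he)).symm

/-- In an expander, two large sets are unlikely to be separated by percolation. -/
lemma CheegerLB.measure_not_openConn_le {h : ℝ} (hpos : 0 < h) (hG : CheegerLB G h) {d : ℕ}
    (hd0 : 0 < d) (hd : ∀ v, (G.neighborSet v).ncard ≤ d) {A B : Set V} {x : ℝ} (hx : 0 < x)
    (hA : x ≤ A.ncard) (hB : x ≤ B.ncard) {t : ℕ}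
    (ht : d * Fintype.card V ≤ t * (h * x)) {ε : ℝ} (hε : ε ∈ Set.Icc (0 : ℝ) 1)
    {μ : Measure (Sym2 V → Bool)} (hμ : IsBernoulliConfig ε μ) {m : ℕ}
    (hm : 2 * t * m ≤ h * x / 2) :
    μ {ω | ∀ a ∈ A, ∀ b ∈ B, ¬ G.OpenConn ω a b} ≤ ENNReal.ofReal (1 - ε ^ (2 * t)) ^ m := by
  classical
  have := hμ.1
  let N : Finset (Sym2 V) → Set (Sym2 V → Bool) := fun F =>
    {ω | ∀ a ∈ A, ∀ b ∈ B, ¬ G.OpenConn (fun e => ω e && decide (e ∉ F)) a b}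
  have key : ∀ (m : ℕ) (F : Finset (Sym2 V)), F.card + 2 * t * m ≤ h * x / 2 →
      μ (N F) ≤ ENNReal.ofReal (1 - ε ^ (2 * t)) ^ m := by
    intro m
    induction m with
    | zero => intro F _; simpa using prob_le_one
    | succ m ih =>
      intro F hF
      push_cast at hF
      have hF0 : (F.card : ℝ) ≤ h * x / 2 := by
        have : (0 : ℝ) ≤ 2 * t * (m + 1) := by positivity
        linarith
      obtain ⟨γ, hγF, hγt, a, ha, b, hb, hab⟩ := hG.exists_short_path hpos hd0 hd hx hA hB hF0 ht
      have hih := ih (F ∪ γ) (by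
        have h1 : ((F ∪ γ).card : ℝ) ≤ F.card + γ.card := by exact_mod_cast Finset.card_union_le F γ
        have h2 : (γ.card : ℝ) ≤ 2 * t := by exact_mod_cast hγt
        linarith)
      have hsub : N F ⊆ {ω | ∀ e ∈ γ, ω e = true}ᶜ ∩ N (F ∪ γ) := by
        intro ω hω
        refine ⟨fun hγω => hω a ha b hb (hab _ fun e he => ?_), fun x hx y hy hxy => ?_⟩
        · have h1 : ω e = true := hγω e he
          have h2 : e ∉ F := Finset.disjoint_left.mp hγF he
          simp [h1, h2]
        · refine hω x hx y hy (hxy.mono fun e he => ?_)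
          simp only [Finset.mem_union, not_or, Bool.and_eq_true, decide_eq_true_eq] at he ⊢
          exact ⟨he.1, he.2.1⟩
      have hclosed : μ {ω | ∀ e ∈ γ, ω e = true}ᶜ ≤ ENNReal.ofReal (1 - ε ^ (2 * t)) := by
        rw [prob_compl_eq_one_sub (Set.toFinite _).measurableSet, hμ.2 γ fun _ => true]
        simp only [if_true, Finset.prod_const]
        rw [← ENNReal.ofReal_pow hε.1, ← ENNReal.ofReal_one,
          ← ENNReal.ofReal_sub _ (pow_nonneg hε.1 _)]
        exact ENNReal.ofReal_le_ofReal (sub_le_sub_left (pow_le_pow_of_le_one hε.1 hε.2 hγt) 1)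
      refine (measure_mono hsub).trans ?_
      rw [hμ.measure_inter hε (s := (γ : Set (Sym2 V))) (t := ((F ∪ γ : Finset (Sym2 V)) : Set _)ᶜ)
        ?_ ?_ ?_, pow_succ']
      · exact mul_le_mul' hclosed hih
      · rw [Set.disjoint_compl_right_iff_subset]
        exact_mod_cast Finset.subset_union_right
      · intro ω ω' hωω' hω hω'
        exact hω fun e he => (hωω' e he).trans (hω' e he)
      · intro ω ω' hωω' hω
        have : (fun e => ω' e && decide (e ∉ F ∪ γ)) = fun e => ω e && decide (e ∉ F ∪ γ) := by
          funext e
          by_cases he : e ∈ F ∪ γ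
          · simp only [he, not_true_eq_false, decide_false, Bool.and_false]
          · rw [hωω' e (by simpa using he)]
        change ∀ a ∈ A, ∀ b ∈ B, ¬ G.OpenConn (fun e => ω' e && decide (e ∉ F ∪ γ)) a b
        rw [this]
        exact hω
  have h0 := key m ∅ (by simpa using hm)
  simpa [N] using h0

lemma SimpleGraph.exists_closed_split (G : SimpleGraph V) {ω : Sym2 V → Bool} {L : Set V} {y : ℝ}
    (hL : 3 * y ≤ L.ncard) (hω : ∀ v, ({w | G.OpenConn ω v w}.ncard : ℝ) ≤ y) (hy : 0 ≤ y) :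
    ∃ A : Set V, (∀ a ∈ A, ∀ b, G.OpenConn ω a b → b ∈ A) ∧ y ≤ (A ∩ L).ncard ∧
      y ≤ (L \ A).ncard := by
  classical
  have hfin : {A : Set V | (∀ a ∈ A, ∀ b, G.OpenConn ω a b → b ∈ A) ∧
      ((A ∩ L).ncard : ℝ) ≤ 2 * y}.Finite := Set.toFinite _
  obtain ⟨A, ⟨hcl, hA2⟩, hmax⟩ := hfin.exists_maximal ⟨∅, by simp, by simpa using hy⟩
  have hsplit : ((A ∩ L).ncard : ℝ) + (L \ A).ncard = L.ncard := by
    have := Set.ncard_inter_add_ncard_sdiff_eq_ncard L A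
    rw [Set.inter_comm] at this
    exact_mod_cast this
  refine ⟨A, hcl, ?_, by linarith⟩
  by_contra! hlt
  have hne : (L \ A).Nonempty := by
    rw [← Set.ncard_pos (Set.toFinite _)]
    have : (0 : ℝ) < (L \ A).ncard := by linarith
    exact_mod_cast this
  obtain ⟨v, hvL, hvA⟩ := hne
  refine hvA (hmax (y := A ∪ {w | G.OpenConn ω v w}) ⟨?_, ?_⟩ Set.subset_union_left
    (Or.inr Relation.ReflTransGen.refl))
  · rintro a (ha | ha) b hab
    · exact Or.inl (hcl a ha b hab)
    · exact Or.inr (SimpleGraph.OpenConn.trans ha hab)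
  · have h1 : ((A ∪ {w | G.OpenConn ω v w}) ∩ L).ncard ≤
        (A ∩ L).ncard + {w | G.OpenConn ω v w}.ncard := by
      refine (Set.ncard_le_ncard ?_ (Set.toFinite _)).trans (Set.ncard_union_le _ _)
      rintro w ⟨hw | hw, hwL⟩
      · exact Or.inl ⟨hw, hwL⟩
      · exact Or.inr hw
    have h2 : (((A ∪ {w | G.OpenConn ω v w}) ∩ L).ncard : ℝ) ≤
        (A ∩ L).ncard + {w | G.OpenConn ω v w}.ncard := by exact_mod_cast h1
    have := hω v
    linarith

/-- There are few unions of clusters of size at least `K`. -/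
lemma SimpleGraph.ncard_closed_le (G : SimpleGraph V) (ω : Sym2 V → Bool) {K : ℕ} (hK : 0 < K) :
    {A : Set V | A ⊆ {v | ω ∈ G.clusterGE v K} ∧
      ∀ a ∈ A, ∀ b, G.OpenConn ω a b → b ∈ A}.ncard ≤ 2 ^ (Fintype.card V / K) := by
  classical
  let c : V → Set V := fun v => {w | G.OpenConn ω v w}
  have hc : ∀ {v w}, G.OpenConn ω v w → c w = c v := by
    intro v w hvw
    ext x
    exact ⟨fun hx => hvw.trans hx, fun hx => hvw.symm.trans hx⟩
  set L := {v | ω ∈ G.clusterGE v K} with hL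
  have hQ : (L.toFinset.image c).card ≤ Fintype.card V / K := by
    rw [Nat.le_div_iff_mul_le hK, mul_comm]
    refine (Finset.mul_card_image_le_card L.toFinset K fun S hS => ?_).trans
      (Finset.card_le_univ _)
    obtain ⟨v, hv, rfl⟩ := Finset.mem_image.mp hS
    have hvL : v ∈ L := Set.mem_toFinset.mp hv
    have hvK : K ≤ (c v).ncard := hvL
    refine hvK.trans ?_
    rw [Set.ncard_eq_toFinset_card']
    refine Finset.card_le_card fun w hw => ?_
    have hwc : w ∈ c v := Set.mem_toFinset.mp hw
    have hvw : G.OpenConn ω v w := hwc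
    have hcw := hc hvw
    rw [Finset.mem_filter, Set.mem_toFinset]
    refine ⟨?_, hcw⟩
    change K ≤ (c w).ncard
    rw [hcw]
    exact hvK
  calc _ ≤ ((L.toFinset.image c).powerset : Set (Finset (Set V))).ncard := by
        refine Set.ncard_le_ncard_of_injOn (fun A => A.toFinset.image c) ?_ ?_ (Set.toFinite _)
        · rintro A ⟨hA, -⟩
          simp only [Finset.coe_powerset, Set.mem_preimage, Set.mem_powerset_iff, Finset.coe_subset]
          exact Finset.image_subset_image (Set.toFinset_subset_toFinset.mpr hA)
        · have hsub : ∀ A B : Set V, (∀ a ∈ B, ∀ b, G.OpenConn ω a b → b ∈ B) →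
              A.toFinset.image c = B.toFinset.image c → A ⊆ B := by
            intro A B hB hAB a ha
            have h1 : c a ∈ B.toFinset.image c := by
              rw [← hAB]
              exact Finset.mem_image_of_mem _ (by simpa using ha)
            obtain ⟨b, hb, hbc⟩ := Finset.mem_image.mp h1
            refine hB b (by simpa using hb) a ?_
            change a ∈ c b
            rw [hbc]
            exact Relation.ReflTransGen.refl
          intro A hA B hB hAB
          exact Set.Subset.antisymm (hsub A B hB.2 hAB) (hsub B A hA.2 hAB.symm)
    _ = 2 ^ (L.toFinset.image c).card := by rw [Set.ncard_coe_finset, Finset.card_powerset]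
    _ ≤ _ := Nat.pow_le_pow_right (by norm_num) hQ

/-- Sprinkling merges the large clusters into a giant one, with high probability. -/
lemma CheegerLB.measure_sprinkling_le {h : ℝ} (hpos : 0 < h) (hG : CheegerLB G h) {d : ℕ}
    (hd0 : 0 < d) (hd : ∀ v, (G.neighborSet v).ncard ≤ d) {y : ℝ} (hy : 0 < y) {t : ℕ}
    (ht : d * Fintype.card V ≤ t * (h * y)) {ε : ℝ} (hε : ε ∈ Set.Icc (0 : ℝ) 1)
    {μ : Measure (Sym2 V → Bool)} (hμ : IsBernoulliConfig ε μ) {m : ℕ}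
    (hm : 2 * t * m ≤ h * y / 2) {K : ℕ} (hK : 0 < K) {ω : Sym2 V → Bool}
    (hω : 3 * y ≤ {v | ω ∈ G.clusterGE v K}.ncard) :
    μ {η | ∀ v, ({w | G.OpenConn (fun e => ω e || η e) v w}.ncard : ℝ) < y} ≤
      2 ^ (Fintype.card V / K) * ENNReal.ofReal (1 - ε ^ (2 * t)) ^ m := by
  classical
  set L := {v | ω ∈ G.clusterGE v K} with hL
  let 𝒜 : Set (Set V) := {A | A ⊆ L ∧ ∀ a ∈ A, ∀ b, G.OpenConn ω a b → b ∈ A}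
  let 𝒜' : Finset (Set V) := 𝒜.toFinset.filter fun A => y ≤ A.ncard ∧ y ≤ (L \ A).ncard
  have hsub : {η | ∀ v, ({w | G.OpenConn (fun e => ω e || η e) v w}.ncard : ℝ) < y} ⊆
      ⋃ A ∈ 𝒜', {η | ∀ a ∈ A, ∀ b ∈ L \ A, ¬ G.OpenConn η a b} := by
    intro η hη
    obtain ⟨A, hcl, hA1, hA2⟩ := G.exists_closed_split hω (fun v => (hη v).le) hy.le
    have hLA : L \ (A ∩ L) = L \ A := by
      ext w
      simp only [Set.mem_sdiff, Set.mem_inter_iff, not_and]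
      tauto
    simp only [Set.mem_iUnion]
    refine ⟨A ∩ L, ?_, ?_⟩
    · rw [Finset.mem_filter, Set.mem_toFinset, hLA]
      refine ⟨⟨Set.inter_subset_right, ?_⟩, hA1, hA2⟩
      rintro a ⟨haA, haL⟩ b hab
      refine ⟨hcl a haA b (hab.mono fun e he => by simp [he]), ?_⟩
      refine le_trans (show K ≤ {w | G.OpenConn ω a w}.ncard from haL)
        (Set.ncard_le_ncard ?_ (Set.toFinite _))
      exact fun w hw => hab.symm.trans hw
    · rw [hLA]
      rintro a ⟨haA, -⟩ b ⟨-, hb⟩ hab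
      exact hb (hcl a haA b (hab.mono fun e he => by simp [he]))
  have hcard : 𝒜'.card ≤ 2 ^ (Fintype.card V / K) := by
    refine (Finset.card_filter_le _ _).trans ?_
    rw [← Set.ncard_eq_toFinset_card']
    exact G.ncard_closed_le ω hK
  calc _ ≤ ∑ A ∈ 𝒜', μ {η | ∀ a ∈ A, ∀ b ∈ L \ A, ¬ G.OpenConn η a b} :=
        (measure_mono hsub).trans (measure_biUnion_finset_le _ _)
    _ ≤ 𝒜'.card • ENNReal.ofReal (1 - ε ^ (2 * t)) ^ m := by
        refine Finset.sum_le_card_nsmul _ _ _ fun A hA => ?_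
        obtain ⟨-, hA1, hA2⟩ := Finset.mem_filter.mp hA
        exact hG.measure_not_openConn_le hpos hd0 hd hy hA1 hA2 ht hε hμ hm
    _ ≤ _ := by
        rw [nsmul_eq_mul]
        gcongr
        exact_mod_cast hcard

/-- In an expander, if with high probability Bernoulli(`q`) percolation has many vertices in
clusters of size at least `K`, then sprinkling up to a Bernoulli(`p`) configuration creates a
giant cluster with high probability. -/
lemma CheegerLB.measure_no_giant_le {h : ℝ} (hpos : 0 < h) (hG : CheegerLB G h) {d : ℕ}
    (hd0 : 0 < d) (hd : ∀ v, (G.neighborSet v).ncard ≤ d) {y : ℝ} (hy : 0 < y) {t : ℕ}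
    (ht : d * Fintype.card V ≤ t * (h * y)) {p q ε : ℝ} (hp : p ∈ Set.Icc (0 : ℝ) 1)
    (hq : q ∈ Set.Icc (0 : ℝ) 1) (hε : ε ∈ Set.Icc (0 : ℝ) 1)
    (hpq : 1 - p = (1 - q) * (1 - ε)) {μ κ : Measure (Sym2 V → Bool)}
    (hμ : IsBernoulliConfig p μ) (hκ : IsBernoulliConfig q κ) {m : ℕ}
    (hm : 2 * t * m ≤ h * y / 2) {K : ℕ} (hK : 0 < K) :
    μ {ω | ∀ v, ({w | G.OpenConn ω v w}.ncard : ℝ) < y} ≤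
      κ {ω | ({v | ω ∈ G.clusterGE v K}.ncard : ℝ) < 3 * y} +
        2 ^ (Fintype.card V / K) * ENNReal.ofReal (1 - ε ^ (2 * t)) ^ m := by
  classical
  have hκ' := isBernoulliConfig_pi (E := Sym2 V) hε
  have := hκ.1
  have := hκ'.1
  set κ' := Measure.pi fun _ : Sym2 V => bernoulliBool ε
  set b := 2 ^ (Fintype.card V / K) * ENNReal.ofReal (1 - ε ^ (2 * t)) ^ m
  set S := {ω : Sym2 V → Bool | ({v | ω ∈ G.clusterGE v K}.ncard : ℝ) < 3 * y}
  rw [hμ.map_or hp hq hε hpq hκ hκ', Measure.map_apply (measurable_of_countable _)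
    (Set.toFinite _).measurableSet, Measure.prod_apply (Set.toFinite _).measurableSet]
  calc _ ≤ ∫⁻ ω, (S.indicator 1 ω + b) ∂κ := by
        refine lintegral_mono fun ω => ?_
        by_cases hω : ω ∈ S
        · simp only [Set.indicator_of_mem hω, Pi.one_apply]
          exact prob_le_one.trans le_self_add
        · simp only [Set.indicator_of_notMem hω, zero_add]
          exact hG.measure_sprinkling_le hpos hd0 hd hy ht hε hκ' hm hK (not_lt.mp hω)
    _ = κ S + b := by
        rw [lintegral_add_right _ measurable_const,
          lintegral_indicator_one (Set.toFinite _).measurableSet, lintegral_const, measure_univ,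
          mul_one]

end Expander

section Limit

lemma BallIso.connected {V W : Type*} {H : SimpleGraph V} {u : V} {G : SimpleGraph W} {ρ : W}
    (hH : H.Connected) (hiso : BallIso H u G ρ 0) : G.Connected := by
  obtain ⟨φ, -⟩ := hiso
  have hreach : ∀ w, G.Reachable ρ w := by
    intro w
    by_contra hw
    have h0 : G.dist ρ w = 0 := SimpleGraph.dist_eq_zero_of_not_reachable hw
    have hsub : ∀ x y : {w | G.dist ρ w ≤ 0}, x = y := by
      intro x y
      apply φ.symm.injective
      have key : ∀ z : {w | H.dist u w ≤ 0}, (z : V) = u := fun z =>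
        (hH.dist_eq_zero_iff.mp (Nat.le_zero.mp z.2)).symm
      exact Subtype.ext ((key _).trans (key _).symm)
    have heq := hsub ⟨ρ, by simp⟩ ⟨w, h0.le⟩
    have hρw : ρ = w := congrArg Subtype.val heq
    exact hw (hρw ▸ SimpleGraph.Reachable.refl ρ)
  have : Nonempty W := ⟨ρ⟩
  exact ⟨fun a b => (hreach a).symm.trans (hreach b)⟩

lemma measure_hasInfiniteCluster_one_pos {W : Type*} [Infinite W] [Countable W]
    {G : SimpleGraph W} (hG : G.Connected) {μ : Measure (Sym2 W → Bool)}
    (hμ : IsBernoulliConfig 1 μ) : 0 < μ {ω | G.HasInfiniteCluster ω} := by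
  have := hμ.1
  have hcount : Countable (Sym2 W) := Quot.mk_surjective.countable
  have hnull : μ (⋃ e, {ω : Sym2 W → Bool | ω e = false}) = 0 := by
    refine measure_iUnion_null fun e => ?_
    have h1 := hμ.2 {e} fun _ => false
    simpa using h1
  rw [pos_iff_ne_zero]
  intro h0
  have huniv : (Set.univ : Set (Sym2 W → Bool)) ⊆
      (⋃ e, {ω : Sym2 W → Bool | ω e = false}) ∪ {ω | G.HasInfiniteCluster ω} := by
    intro ω _
    by_cases hω : ∃ e, ω e = false
    · exact Or.inl (Set.mem_iUnion.mpr hω)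
    · right
      have hω' : ∀ e, ω e = true := by simpa using hω
      obtain ⟨v⟩ := hG.nonempty
      refine ⟨v, ?_⟩
      have : {w | G.OpenConn ω v w} = Set.univ := by
        refine Set.eq_univ_of_forall fun w => ?_
        have hvw := hG.preconnected v w
        rw [SimpleGraph.reachable_iff_reflTransGen] at hvw
        change G.OpenConn ω v w
        induction hvw with
        | refl => exact Relation.ReflTransGen.refl
        | tail _ h ih => exact ih.tail ⟨h, hω' _⟩
      rw [this]
      exact Set.infinite_univ
  have h1 := (measure_mono huniv).trans (measure_union_le (μ := μ) _ _)
  rw [hnull, h0, measure_univ] at h1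
  simp at h1

/-- Entropy is beaten by the exponential decay of the separation probability. -/
lemma two_pow_mul_pow_le {x : ENNReal} {j : ℕ} (hx : x ≤ 1) (hj : x ^ j ≤ 4⁻¹) (m : ℕ) :
    2 ^ (m / j) * x ^ m ≤ (2⁻¹ : ENNReal) ^ (m / j) := by
  have h1 : x ^ m ≤ (x ^ j) ^ (m / j) := by
    rw [← pow_mul]
    exact pow_le_pow_of_le_one zero_le hx (Nat.mul_div_le m j)
  have h2 : (2 : ENNReal) * 4⁻¹ = 2⁻¹ := by
    have h4 : (4 : ENNReal) = 2 * 2 := by norm_num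
    rw [h4, ENNReal.mul_inv (Or.inl (by norm_num)) (Or.inl (by norm_num)), ← mul_assoc,
      ENNReal.mul_inv_cancel (by norm_num) (by norm_num), one_mul]
  calc 2 ^ (m / j) * x ^ m ≤ 2 ^ (m / j) * (4⁻¹) ^ (m / j) :=
        mul_le_mul' le_rfl (h1.trans (pow_le_pow_left' hj _))
    _ = _ := by rw [← mul_pow, h2]

end Limit

/-- let `G_n` be finite graphs with `|G_n| = n`, maximum degree at most `d` and
Cheeger constant at least `h > 0`, converging weakly to a rooted infinite bounded-degree graph
`(G, ρ)`. If `p > p_c(G)`, then there is `α > 0` such that the probability that Bernoulli(`p`)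
bond percolation on `G_n` contains a connected component of size at least `α n` tends to `1`. -/
theorem stmt_12 (V : ℕ → Type*) [∀ n, Fintype (V n)] (Gn : ∀ n, SimpleGraph (V n))
    (hcard : ∀ n, Fintype.card (V n) = n)
    (d : ℕ) (hdegn : ∀ n v, ((Gn n).neighborSet v).ncard ≤ d)
    (h : ℝ) (hpos : 0 < h) (hcheeger : ∀ n, CheegerLB (Gn n) h)
    {W : Type*} [Infinite W] (G : SimpleGraph W) (ρ : W)
    (hdeg : ∀ w, (G.neighborSet w).Finite ∧ (G.neighborSet w).ncard ≤ d)
    (hconv : ∀ R : ℕ,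
      Tendsto (fun n => ({v : V n | BallIso (Gn n) v G ρ R}.ncard : ℝ) / n) atTop (nhds 1))
    (ν : ℝ → Measure (Sym2 W → Bool))
    (hν : ∀ q ∈ Set.Icc (0 : ℝ) 1, IsBernoulliConfig q (ν q))
    (p : ℝ) (hp : p ∈ Set.Icc (0 : ℝ) 1) (hsup : percThreshold G ν < p)
    (μn : ∀ n, Measure (Sym2 (V n) → Bool)) (hμn : ∀ n, IsBernoulliConfig p (μn n)) :
    ∃ α : ℝ, 0 < α ∧
      Tendsto
        (fun n => μn n {ω | ∃ v, α * n ≤ ({w | (Gn n).OpenConn ω v w}.ncard : ℝ)})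
        atTop (nhds 1) := by
  classical
  have hlarge : ∀ R : ℕ, ∀ᶠ n : ℕ in atTop, 0 < n ∧
      (n : ℝ) / 2 ≤ ({v : V n | BallIso (Gn n) v G ρ R}.ncard : ℝ) := by
    intro R
    filter_upwards [(hconv R).eventually_const_lt (show (1 / 2 : ℝ) < 1 by norm_num),
      eventually_gt_atTop 0] with n hn hn0
    have hn0' : (0 : ℝ) < n := by exact_mod_cast hn0
    refine ⟨hn0, ?_⟩
    rw [lt_div_iff₀ hn0'] at hn
    linarith
  have hex : ∀ R : ℕ, ∃ n, ∃ v : V n, 0 < n ∧ BallIso (Gn n) v G ρ R := by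
    intro R
    obtain ⟨n, hn0, hn⟩ := (hlarge R).exists
    have hn0' : (0 : ℝ) < n := by exact_mod_cast hn0
    have h1 : (0 : ℝ) < ({v : V n | BallIso (Gn n) v G ρ R}.ncard : ℝ) := by linarith
    obtain ⟨v, hv⟩ := (Set.ncard_pos (Set.toFinite _)).mp (by exact_mod_cast h1)
    exact ⟨n, v, hn0, hv⟩
  have hGn : ∀ n, 0 < n → (Gn n).Connected := by
    intro n hn
    have : Nonempty (V n) := Fintype.card_pos_iff.mp (by rw [hcard n]; exact hn)
    exact (hcheeger n).connected hpos
  have hG : G.Connected := by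
    obtain ⟨n, v, hn0, hv⟩ := hex 0
    exact hv.connected (hGn n hn0)
  have hfin : ∀ R, {w | G.dist ρ w ≤ R}.Finite := by
    intro R
    obtain ⟨n, v, -, φ, -⟩ := hex R
    exact Finite.of_equiv _ φ.toEquiv
  have hcount : Countable W := by
    have huniv : (Set.univ : Set W) = ⋃ R, {w | G.dist ρ w ≤ R} := by
      ext w
      simp only [Set.mem_univ, Set.mem_iUnion, true_iff]
      exact ⟨G.dist ρ w, le_refl (G.dist ρ w)⟩
    rw [← Set.countable_univ_iff, huniv]
    exact Set.countable_iUnion fun R => (hfin R).countable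
  obtain ⟨q, ⟨hq, hqinf⟩, hqp⟩ := exists_lt_of_csInf_lt
    (⟨1, ⟨by norm_num, le_rfl⟩,
      measure_hasInfiniteCluster_one_pos hG (hν 1 ⟨by norm_num, le_rfl⟩)⟩ :
      {p | p ∈ Set.Icc (0 : ℝ) 1 ∧ 0 < ν p {ω | G.HasInfiniteCluster ω}}.Nonempty) hsup
  obtain ⟨q', hqq', hq'p⟩ := exists_between hqp
  have hq' : q' ∈ Set.Icc (0 : ℝ) 1 := ⟨hq.1.trans hqq'.le, hq'p.le.trans hp.2⟩
  obtain ⟨θ, hθ, hθK⟩ := exists_le_measure_clusterGE hG hfin hq hq' hqq' (hν q hq) hqinf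
  obtain ⟨ε, hε0, hε1, hε⟩ := exists_sprinkling hq'p hp.2
  have hhθ : 0 < h * θ := mul_pos hpos hθ
  obtain ⟨t, ht⟩ := exists_nat_ge (12 * (d + 1 : ℝ) / (h * θ))
  rw [div_le_iff₀ hhθ] at ht
  obtain ⟨M, hM⟩ := exists_nat_gt (48 * (t : ℝ) / (h * θ))
  have hM0 : (0 : ℝ) < M := lt_of_le_of_lt (by positivity) hM
  rw [div_lt_iff₀ hhθ] at hM
  set x := ENNReal.ofReal (1 - ε ^ (2 * t)) with hx
  have hx1 : x < 1 := by
    rw [hx, ← ENNReal.ofReal_one]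
    exact (ENNReal.ofReal_lt_ofReal_iff one_pos).mpr (by linarith [pow_pos hε0 (2 * t)])
  obtain ⟨j, hj, hj0⟩ := (((ENNReal.tendsto_pow_atTop_nhds_zero_of_lt_one hx1).eventually_le_const
    (show (0 : ENNReal) < 4⁻¹ by simp)).and (eventually_gt_atTop 0)).exists
  have hK0 : 0 < M * j := Nat.mul_pos (by exact_mod_cast hM0) hj0
  obtain ⟨R, hR⟩ := hθK (M * j)
  set D : ℕ := (d + 1) ^ (2 * R) with hD
  have hbound : ∀ᶠ n : ℕ in atTop,
      μn n {ω | ∀ v, ({w | (Gn n).OpenConn ω v w}.ncard : ℝ) < θ / 12 * n} ≤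
        ENNReal.ofReal (8 * D / θ ^ 2 / n) + (2⁻¹ : ENNReal) ^ (n / (M * j)) := by
    filter_upwards [hlarge R] with n ⟨hn0, hn⟩
    have hn0' : (0 : ℝ) < n := by exact_mod_cast hn0
    have hIpos : (0 : ℝ) < ({v : V n | BallIso (Gn n) v G ρ R}.ncard : ℝ) := by linarith
    have hκ := isBernoulliConfig_pi (E := Sym2 (V n)) hq'
    have hm : ((n / M : ℕ) : ℝ) ≤ n / M := Nat.cast_div_le
    have h1 := (hcheeger n).measure_no_giant_le hpos (Nat.succ_pos d)
      (fun v => (hdegn n v).trans (Nat.le_succ d)) (y := θ / 12 * n) (by positivity) (t := t)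
      (by
        rw [hcard n]
        push_cast
        have := mul_le_mul_of_nonneg_right ht hn0'.le
        linarith)
      hp hq' ⟨hε0.le, hε1⟩ hε (hμn n) hκ (m := n / M)
      (by
        have h2 : 2 * (t : ℝ) * (n / M : ℕ) ≤ 2 * t * (n / M) := by gcongr
        refine h2.trans ?_
        rw [mul_div_assoc', div_le_iff₀ hM0]
        have := mul_le_mul_of_nonneg_right hM.le hn0'.le
        linarith)
      hK0
    refine h1.trans (add_le_add ?_ ?_)
    · have h2 := (hGn n hn0).measure_card_large_lt_le (hdegn n) hq' hκ hθ hR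
        ((Set.ncard_pos (Set.toFinite _)).mp (by exact_mod_cast hIpos))
      refine (measure_mono ?_).trans (h2.trans (ENNReal.ofReal_le_ofReal ?_))
      · intro ω hω
        refine lt_of_lt_of_le (Set.mem_ofPred_eq ▸ hω) ?_
        have := mul_le_mul_of_nonneg_left hn hθ.le
        linarith
      · calc (4 * (D : ℝ)) / (θ ^ 2 * {v : V n | BallIso (Gn n) v G ρ R}.ncard)
            ≤ (4 * (D : ℝ)) / (θ ^ 2 * (n / 2)) := by gcongr
          _ = _ := by field_simp; ring
    · rw [hcard n, ← Nat.div_div_eq_div_mul]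
      exact two_pow_mul_pow_le hx1.le hj _
  have hlim : Tendsto (fun n : ℕ => ENNReal.ofReal (8 * D / θ ^ 2 / n) +
      (2⁻¹ : ENNReal) ^ (n / (M * j))) atTop (nhds 0) := by
    have h1 : Tendsto (fun n : ℕ => ENNReal.ofReal (8 * D / θ ^ 2 / n)) atTop (nhds 0) := by
      have := ENNReal.tendsto_ofReal (tendsto_const_div_atTop_nhds_zero_nat (8 * (D : ℝ) / θ ^ 2))
      simpa using this
    have h2 : Tendsto (fun n : ℕ => (2⁻¹ : ENNReal) ^ (n / (M * j))) atTop (nhds 0) :=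
      (ENNReal.tendsto_pow_atTop_nhds_zero_of_lt_one (by simp)).comp
        (Nat.tendsto_div_const_atTop hK0.ne')
    simpa using h1.add h2
  refine ⟨θ / 12, by positivity, ?_⟩
  have hlow := ENNReal.Tendsto.sub (tendsto_const_nhds (x := (1 : ENNReal))) hlim
    (Or.inl ENNReal.one_ne_top)
  rw [tsub_zero] at hlow
  refine tendsto_of_tendsto_of_tendsto_of_le_of_le' hlow tendsto_const_nhds ?_ ?_
  · filter_upwards [hbound] with n hn
    have := (hμn n).1
    have hc : {ω | ∃ v, θ / 12 * n ≤ ({w | (Gn n).OpenConn ω v w}.ncard : ℝ)} =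
        {ω | ∀ v, ({w | (Gn n).OpenConn ω v w}.ncard : ℝ) < θ / 12 * n}ᶜ := by
      ext ω
      simp
    rw [hc, prob_compl_eq_one_sub (Set.toFinite _).measurableSet]
    exact tsub_le_tsub_left hn 1
  · filter_upwards with n
    have := (hμn n).1
    exact prob_le_one
end

section
/- Let G be a finite graph with n vertices, maximum degree ≤ d, and Cheeger constant ≥ h. Suppose the vertex set contains at most m ≤ n/R disjoint connected 'large' sets, each of size ≥ R, with total size ≥ δn/6. Perform Bernoulli(ε) bond percolation on G. Then the probability that there exists a partition of the large sets into two groups A, B each covering at least δn/12 vertices with no ε-open path joining A to B is at most exp(n/R − ε^{12d/(hδ)}·hδn/24). In particular this probability tends to 0 as n → ∞ provided 1/R < ε^{12d/(hδ)}·hδ. -/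
open MeasureTheory Filter

namespace SimpleGraph

variable {V : Type*} [DecidableEq V] {G : SimpleGraph V}

/-- The net number of times the walk `p` traverses the pair `(u, v)`. -/
def Walk.netFlow {a b : V} (p : G.Walk a b) (u v : V) : ℤ :=
  ((p.darts.map Dart.toProd).count (u, v) : ℤ) - (p.darts.map Dart.toProd).count (v, u)

theorem Walk.netFlow_antisymm {a b : V} (p : G.Walk a b) (u v : V) :
    p.netFlow u v = -p.netFlow v u := by
  simp [netFlow]

theorem Walk.sum_netFlow [Fintype V] {a b : V} (p : G.Walk a b) (x : V) :
    ∑ v, p.netFlow x v = (if x = a then 1 else 0) - (if x = b then 1 else 0) := by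
  induction p with
  | nil => simp [netFlow]
  | @cons a c b hadj p ih =>
    have key : ∀ v, (Walk.cons hadj p).netFlow x v = p.netFlow x v
        + ((if x = a then (if c = v then 1 else 0) else 0)
          - (if x = c then (if a = v then 1 else 0) else 0)) := by
      intro v
      simp only [netFlow, darts_cons, List.map_cons, List.count_cons, Nat.cast_add, Nat.cast_ite,
        beq_iff_eq, Prod.mk.injEq]
      push_cast
      grind
    simp_rw [key, Finset.sum_add_distrib, ih, Finset.sum_sub_distrib]
    by_cases h1 : x = a <;> by_cases h2 : x = c <;> simp [h1, h2]

theorem Walk.IsPath.count_darts_le_one {a b : V} {p : G.Walk a b} (hp : p.IsPath) (u v : V) :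
    (p.darts.map Dart.toProd).count (u, v) ≤ 1 :=
  List.nodup_iff_count_le_one.mp
    ((Walk.darts_nodup_of_support_nodup hp.support_nodup).map Dart.toProd_injective) _

/-- If every set containing `A` and avoiding `B` has an outgoing edge satisfying `P`, then some
path from `A` to `B` has all its darts satisfying `P`. -/
theorem exists_isPath_of_forall_cut {A B : Set V} (P : V → V → Prop)
    (hcut : ∀ S : Set V, A ⊆ S → Disjoint S B → ∃ u ∈ S, ∃ v ∉ S, G.Adj u v ∧ P u v) :
    ∃ a ∈ A, ∃ b ∈ B, ∃ p : G.Walk a b, p.IsPath ∧ ∀ e ∈ p.darts, P e.fst e.snd := by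
  set S : Set V := {v | ∃ a ∈ A, ∃ p : G.Walk a v, ∀ e ∈ p.darts, P e.fst e.snd}
  have hAS : A ⊆ S := fun a ha => ⟨a, ha, Walk.nil, by simp⟩
  by_cases hSB : Disjoint S B
  · obtain ⟨u, ⟨a, ha, p, hp⟩, v, hv, huv, hP⟩ := hcut S hAS hSB
    refine absurd ⟨a, ha, p.concat huv, fun e he => ?_⟩ hv
    rw [Walk.darts_concat, List.concat_eq_append, List.mem_append, List.mem_singleton] at he
    rcases he with he | rfl
    exacts [hp e he, hP]
  · obtain ⟨b, ⟨a, ha, p, hp⟩, hb⟩ := Set.not_disjoint_iff.mp hSB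
    exact ⟨a, ha, b, hb, p.bypass, p.bypass_isPath,
      fun e he => hp e (p.darts_bypass_subset_darts he)⟩

/-- An integral flow with unit capacities in `G`, conserved outside `A` and `B`. -/
structure IsUnitFlow [Fintype V] (G : SimpleGraph V) (A B : Set V) (f : V → V → ℤ) : Prop where
  antisymm : ∀ u v, f u v = -f v u
  le_one : ∀ u v, f u v ≤ 1
  adj : ∀ u v, f u v ≠ 0 → G.Adj u v
  conserve : ∀ u, u ∉ A → u ∉ B → ∑ v, f u v = 0

theorem sum_sum_eq_sum_cut [Fintype V] {f : V → V → ℤ} (hf : ∀ u v, f u v = -f v u)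
    (S : Finset V) : ∑ u ∈ S, ∑ v, f u v = ∑ u ∈ S, ∑ v ∈ Sᶜ, f u v := by
  have h0 : ∑ u ∈ S, ∑ v ∈ S, f u v = 0 := by
    have h1 : ∑ u ∈ S, ∑ v ∈ S, f u v = -∑ u ∈ S, ∑ v ∈ S, f u v := by
      conv_lhs => rw [Finset.sum_comm]
      simp_rw [← Finset.sum_neg_distrib]
      exact Finset.sum_congr rfl fun u _ => Finset.sum_congr rfl fun v _ => hf v u
    omega
  rw [← zero_add (∑ u ∈ S, ∑ v ∈ Sᶜ, f u v), ← h0, ← Finset.sum_add_distrib]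
  exact Finset.sum_congr rfl fun u _ => (Finset.sum_add_sum_compl S _).symm

theorem IsUnitFlow.value_eq_sum_cut [Fintype V] {A B S : Finset V} {f : V → V → ℤ}
    (hf : G.IsUnitFlow A B f) (hAS : A ⊆ S) (hSB : Disjoint S B) :
    ∑ u ∈ A, ∑ v, f u v = ∑ u ∈ S, ∑ v ∈ Sᶜ, f u v := by
  rw [← sum_sum_eq_sum_cut hf.antisymm]
  exact Finset.sum_subset hAS fun u hu hA => hf.conserve u (by simpa using hA)
    (by simpa using Finset.disjoint_left.mp hSB hu)

theorem Walk.value_netFlow [Fintype V] {A B : Finset V} (hAB : Disjoint A B) {a b : V}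
    (ha : a ∈ A) (hb : b ∈ B) (p : G.Walk a b) : ∑ u ∈ A, ∑ v, p.netFlow u v = 1 := by
  have hbA : b ∉ A := Finset.disjoint_right.mp hAB hb
  simp [Walk.sum_netFlow, Finset.sum_sub_distrib, ha, hbA]

theorem Walk.sum_netFlow_eq_zero [Fintype V] {A B : Set V} {a b : V} (ha : a ∈ A) (hb : b ∈ B)
    (p : G.Walk a b) {u : V} (huA : u ∉ A) (huB : u ∉ B) : ∑ v, p.netFlow u v = 0 := by
  have h1 : u ≠ a := fun h => huA (h ▸ ha)
  have h2 : u ≠ b := fun h => huB (h ▸ hb)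
  simp [Walk.sum_netFlow, h1, h2]

theorem Walk.exists_mem_darts_of_count_ne_zero {a b : V} {p : G.Walk a b} {u v : V}
    (h : (p.darts.map Dart.toProd).count (u, v) ≠ 0) :
    ∃ e ∈ p.darts, e.fst = u ∧ e.snd = v := by
  have := List.count_pos_iff.mp (Nat.pos_of_ne_zero h)
  obtain ⟨e, he, h⟩ := List.mem_map.mp this
  exact ⟨e, he, congrArg Prod.fst h, congrArg Prod.snd h⟩

/-- A unit flow of every value up to the minimum cut exists. -/
theorem exists_isUnitFlow [Fintype V] [DecidableRel G.Adj] {A B : Finset V} (hAB : Disjoint A B)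
    (k : ℕ) (hcut : ∀ S : Finset V, A ⊆ S → Disjoint S B →
      k ≤ ((S ×ˢ Sᶜ).filter fun x => G.Adj x.1 x.2).card) :
    ∃ f, G.IsUnitFlow A B f ∧ ∑ u ∈ A, ∑ v, f u v = k := by
  induction k with
  | zero => exact ⟨fun _ _ => 0, ⟨by simp, by simp, by simp, by simp⟩, by simp⟩
  | succ k ih =>
    obtain ⟨f, hf, hval⟩ := ih fun S h1 h2 => (Nat.le_succ k).trans (hcut S h1 h2)
    obtain ⟨a, ha, b, hb, p, hp, hdart⟩ := exists_isPath_of_forall_cut (G := G) (A := (A : Set V))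
        (B := (B : Set V)) (fun u v => f u v ≤ 0) (by
      classical
      intro S hAS hSB
      by_contra! hcon
      have hAS' : A ⊆ S.toFinset := fun x hx => by simpa using hAS hx
      have hSB' : Disjoint S.toFinset B := by
        rw [← Finset.disjoint_coe]; simpa using hSB
      have h1 := hf.value_eq_sum_cut hAS' hSB'
      have h2 := hcut _ hAS' hSB'
      rw [hval, ← Finset.sum_product'] at h1
      have h3 : (((S.toFinset ×ˢ S.toFinsetᶜ).filter fun x => G.Adj x.1 x.2).card : ℤ) ≤ k := by
        rw [h1, Finset.card_filter, Nat.cast_sum]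
        refine Finset.sum_le_sum fun x hx => ?_
        simp only [Finset.mem_product, Set.mem_toFinset, Finset.mem_compl] at hx
        by_cases hadj : G.Adj x.1 x.2
        · have := hcon _ hx.1 _ hx.2 hadj
          simp only [hadj, if_true]
          push_cast
          omega
        · have : f x.1 x.2 = 0 := by
            by_contra h0
            exact hadj (hf.adj _ _ h0)
          simp [hadj, this]
      omega)
    refine ⟨fun u v => f u v + p.netFlow u v, ⟨fun u v => ?_, fun u v => ?_, fun u v h => ?_,
      fun u hA hB => ?_⟩, ?_⟩
    · rw [hf.antisymm u v, p.netFlow_antisymm u v, neg_add]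
    · have h1 := hp.count_darts_le_one u v
      have h2 := hf.le_one u v
      by_cases h0 : (p.darts.map Dart.toProd).count (u, v) = 0
      · simp only [Walk.netFlow]; omega
      · obtain ⟨e, he, rfl, rfl⟩ := Walk.exists_mem_darts_of_count_ne_zero h0
        have := hdart e he
        simp only [Walk.netFlow]; omega
    · by_contra hadj
      have h0 : f u v = 0 := by
        by_contra h0
        exact hadj (hf.adj _ _ h0)
      have h1 : (p.darts.map Dart.toProd).count (u, v) = 0 := by
        by_contra h1
        obtain ⟨e, he, rfl, rfl⟩ := Walk.exists_mem_darts_of_count_ne_zero h1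
        exact hadj e.adj
      have h2 : (p.darts.map Dart.toProd).count (v, u) = 0 := by
        by_contra h1
        obtain ⟨e, he, rfl, rfl⟩ := Walk.exists_mem_darts_of_count_ne_zero h1
        exact hadj e.adj.symm
      simp [Walk.netFlow, h0, h1, h2] at h
    · rw [Finset.sum_add_distrib, hf.conserve u hA hB, p.sum_netFlow_eq_zero ha hb hA hB, add_zero]
    · simp_rw [Finset.sum_add_distrib]
      rw [hval, p.value_netFlow hAB ha hb]
      push_cast; rfl

/-- A unit flow of value `k` decomposes into `k` edge-disjoint walks from `A` to `B`. -/
theorem IsUnitFlow.exists_walks [Fintype V] {A B : Finset V} (hAB : Disjoint A B)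
    (k : ℕ) (f : V → V → ℤ) (hf : G.IsUnitFlow A B f) (hval : ∑ u ∈ A, ∑ v, f u v = k) :
    ∃ F : Fin k → Finset (Sym2 V), Pairwise (fun i j => Disjoint (F i) (F j)) ∧
      ∀ i, (∃ a ∈ A, ∃ b ∈ B, ∃ p : G.Walk a b, F i = p.edges.toFinset) ∧
        ∀ u v, s(u, v) ∈ F i → f u v ≠ 0 := by
  induction k generalizing f with
  | zero => exact ⟨fun i => i.elim0, fun i => i.elim0, fun i => i.elim0⟩
  | succ k ih =>
    obtain ⟨a, ha, b, hb, p, hp, hdart⟩ := exists_isPath_of_forall_cut (G := G) (A := (A : Set V))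
        (B := (B : Set V)) (fun u v => f u v = 1) (by
      classical
      intro S hAS hSB
      by_contra! hcon
      have hAS' : A ⊆ S.toFinset := fun x hx => by simpa using hAS hx
      have hSB' : Disjoint S.toFinset B := by
        rw [← Finset.disjoint_coe]; simpa using hSB
      have h1 := hf.value_eq_sum_cut hAS' hSB'
      have h3 : ∑ u ∈ S.toFinset, ∑ v ∈ S.toFinsetᶜ, f u v ≤ 0 := by
        refine Finset.sum_nonpos fun u hu => Finset.sum_nonpos fun v hv => ?_
        by_contra! hpos
        have h2 := hf.le_one u v
        exact hcon u (by simpa using hu) v (by simpa using hv) (hf.adj u v hpos.ne') (by omega)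
      omega)
    have hzero : ∀ u v, (p.darts.map Dart.toProd).count (u, v) ≠ 0 →
        f u v = 1 ∧ p.netFlow u v = 1 := by
      intro u v h0
      have h1 := hp.count_darts_le_one u v
      have h2 : f u v = 1 := by
        obtain ⟨e, he, rfl, rfl⟩ := Walk.exists_mem_darts_of_count_ne_zero h0
        exact hdart e he
      have h3 : (p.darts.map Dart.toProd).count (v, u) = 0 := by
        by_contra h3
        obtain ⟨e, he, rfl, rfl⟩ := Walk.exists_mem_darts_of_count_ne_zero h3
        have := hdart e he
        have := hf.antisymm e.fst e.snd
        omega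
      refine ⟨h2, ?_⟩
      simp only [Walk.netFlow]; omega
    have hcases : ∀ u v, f u v - p.netFlow u v = 0 ∧ f u v ≠ 0 ∨
        f u v - p.netFlow u v = f u v ∧ s(u, v) ∉ p.edges := by
      intro u v
      have h1 := hf.antisymm u v
      have h2 := p.netFlow_antisymm u v
      by_cases h3 : (p.darts.map Dart.toProd).count (u, v) = 0
      · by_cases h4 : (p.darts.map Dart.toProd).count (v, u) = 0
        · refine Or.inr ⟨by simp [Walk.netFlow, h3, h4], fun hmem => ?_⟩
          obtain ⟨e, he, heq⟩ := List.mem_map.mp hmem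
          rcases dart_edge_eq_mk'_iff.mp heq with h | h
          · exact List.count_eq_zero.mp h3 (h ▸ List.mem_map_of_mem he)
          · exact List.count_eq_zero.mp h4 (by
              rw [show (v, u) = e.toProd from h.symm]
              exact List.mem_map_of_mem he)
        · have := hzero v u h4
          exact Or.inl (by omega)
      · have := hzero u v h3
        exact Or.inl (by omega)
    obtain ⟨F, hF, hF'⟩ := ih (fun u v => f u v - p.netFlow u v)
      ⟨fun u v => by have := hf.antisymm u v; have := p.netFlow_antisymm u v; omega,
      fun u v => by have := hf.le_one u v; have := hcases u v; omega,
      fun u v h => hf.adj u v (by have := hcases u v; omega),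
      fun u hA hB => by
        rw [Finset.sum_sub_distrib, hf.conserve u hA hB, p.sum_netFlow_eq_zero ha hb hA hB,
          sub_zero]⟩
      (by
        simp_rw [Finset.sum_sub_distrib]
        rw [hval, p.value_netFlow hAB ha hb]
        push_cast; ring)
    have hdisj : ∀ i, Disjoint p.edges.toFinset (F i) := by
      intro i
      refine Finset.disjoint_left.mpr fun e => ?_
      induction e with
      | h u v =>
        intro he hi
        have h1 := (hF' i).2 u v hi
        rcases hcases u v with h | h
        · exact h1 h.1
        · exact h.2 (by simpa using he)
    refine ⟨Fin.cons p.edges.toFinset F, ?_, ?_⟩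
    · intro i j hij
      induction i using Fin.cases with
      | zero =>
        induction j using Fin.cases with
        | zero => exact absurd rfl hij
        | succ j => simpa using hdisj j
      | succ i =>
        induction j using Fin.cases with
        | zero => simpa using (hdisj i).symm
        | succ j => simpa using hF (fun h => hij (congrArg Fin.succ h))
    · intro i
      induction i using Fin.cases with
      | zero =>
        refine ⟨⟨a, ha, b, hb, p, rfl⟩, fun u v he h0 => ?_⟩
        rcases hcases u v with h | h
        · exact h.2 h0
        · exact h.2 (by simpa using he)
      | succ i =>
        refine ⟨by simpa using (hF' i).1, fun u v he h0 => ?_⟩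
        have h1 := (hF' i).2 u v (by simpa using he)
        rcases hcases u v with h | h
        · exact h1 h.1
        · exact h1 (h.1.trans h0)

/-- The edge version of Menger's theorem. -/
theorem exists_edgeDisjoint_walks [Fintype V] [DecidableRel G.Adj] {A B : Finset V}
    (hAB : Disjoint A B) (k : ℕ) (hcut : ∀ S : Finset V, A ⊆ S → Disjoint S B →
      k ≤ ((S ×ˢ Sᶜ).filter fun x => G.Adj x.1 x.2).card) :
    ∃ F : Fin k → Finset (Sym2 V), Pairwise (fun i j => Disjoint (F i) (F j)) ∧
      ∀ i, ∃ a ∈ A, ∃ b ∈ B, ∃ p : G.Walk a b, F i = p.edges.toFinset := by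
  obtain ⟨f, hf, hval⟩ := exists_isUnitFlow hAB k hcut
  obtain ⟨F, hF, hF'⟩ := hf.exists_walks hAB k f hval
  exact ⟨F, hF, fun i => (hF' i).1⟩

end SimpleGraph

theorem SimpleGraph.Walk.openConn {V : Type*} {G : SimpleGraph V} {ω : Sym2 V → Bool} {a b : V}
    (p : G.Walk a b) (hp : ∀ e ∈ p.edges, ω e = true) : G.OpenConn ω a b := by
  induction p with
  | nil => exact Relation.ReflTransGen.refl
  | cons hadj p ih =>
    simp only [Walk.edges_cons, List.mem_cons, forall_eq_or_imp] at hp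
    exact Relation.ReflTransGen.head ⟨hadj, hp.1⟩ (ih hp.2)

/-- The probability that none of several disjoint finite edge sets is fully open, jointly with a
cylinder event on a further disjoint set. -/
theorem IsBernoulliConfig.real_inter_forall_not_open {E ι : Type*} [Finite E] [DecidableEq E]
    [DecidableEq ι] {p : ℝ} (hp : p ∈ Set.Icc (0 : ℝ) 1) {μ : Measure (E → Bool)}
    (hμ : IsBernoulliConfig p μ) {F : ι → Finset E}
    (hF : Pairwise fun i j => Disjoint (F i) (F j)) (J : Finset ι) (T : Finset E) (f : E → Bool)
    (hT : ∀ i ∈ J, Disjoint T (F i)) :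
    μ.real {ω | (∀ e ∈ T, ω e = f e) ∧ ∀ i ∈ J, ¬ ∀ e ∈ F i, ω e = true} =
      (∏ e ∈ T, if f e then p else 1 - p) * ∏ i ∈ J, (1 - p ^ (F i).card) := by
  have := hμ.1
  induction J using Finset.induction_on generalizing T f with
  | empty =>
    simp only [Finset.notMem_empty, false_imp_iff, implies_true, and_true, Finset.prod_empty,
      mul_one, Measure.real, hμ.2 T f, ENNReal.toReal_prod]
    refine Finset.prod_congr rfl fun e _ => ENNReal.toReal_ofReal ?_
    split_ifs <;> linarith [hp.1, hp.2]
  | insert j J hj ih =>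
    have hTJ : ∀ i ∈ J, Disjoint T (F i) := fun i hi => hT i (Finset.mem_insert_of_mem hi)
    have hTj : Disjoint T (F j) := hT j (Finset.mem_insert_self j J)
    have h1 := ih T f hTJ
    have h2 := ih (T ∪ F j) (fun e => if e ∈ T then f e else true) (fun i hi =>
      Finset.disjoint_union_left.mpr ⟨hTJ i hi, hF fun h => hj (h ▸ hi)⟩)
    have hsub : {ω : E → Bool | (∀ e ∈ T ∪ F j, ω e = if e ∈ T then f e else true) ∧
        ∀ i ∈ J, ¬ ∀ e ∈ F i, ω e = true} ⊆
        {ω | (∀ e ∈ T, ω e = f e) ∧ ∀ i ∈ J, ¬ ∀ e ∈ F i, ω e = true} := fun ω hω =>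
      ⟨fun e he => by simpa [he] using hω.1 e (Finset.mem_union_left _ he), hω.2⟩
    have hset : {ω : E → Bool | (∀ e ∈ T, ω e = f e) ∧
        ∀ i ∈ insert j J, ¬ ∀ e ∈ F i, ω e = true} =
        {ω | (∀ e ∈ T, ω e = f e) ∧ ∀ i ∈ J, ¬ ∀ e ∈ F i, ω e = true} \
        {ω | (∀ e ∈ T ∪ F j, ω e = if e ∈ T then f e else true) ∧
          ∀ i ∈ J, ¬ ∀ e ∈ F i, ω e = true} := by
      ext ω
      have hiff : (∀ e ∈ T, ω e = f e) →
          ((∀ e ∈ T ∪ F j, ω e = if e ∈ T then f e else true) ↔ ∀ e ∈ F j, ω e = true) := by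
        intro hω
        refine ⟨fun h e he => ?_, fun h e he => ?_⟩
        · simpa [Finset.disjoint_right.mp hTj he] using h e (Finset.mem_union_right _ he)
        · split_ifs with heT
          · exact hω e heT
          · exact h e ((Finset.mem_union.mp he).resolve_left heT)
      simp only [Finset.forall_mem_insert, Set.mem_ofPred_eq, Set.mem_sdiff]
      tauto
    rw [hset, measureReal_sdiff hsub (Set.toFinite _).measurableSet, h1, h2,
      Finset.prod_union hTj, Finset.prod_insert hj]
    have h3 : ∏ e ∈ T, (if (if e ∈ T then f e else true) = true then p else 1 - p) =
        ∏ e ∈ T, (if f e = true then p else 1 - p) :=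
      Finset.prod_congr rfl fun e he => by simp [he]
    have h4 : ∏ e ∈ F j, (if (if e ∈ T then f e else true) = true then p else 1 - p) =
        p ^ (F j).card := by
      rw [← Finset.prod_const]
      exact Finset.prod_congr rfl fun e he => by simp [Finset.disjoint_right.mp hTj he]
    rw [h3, h4]
    ring

theorem IsBernoulliConfig.real_forall_not_open_le {E ι : Type*} [Finite E] {p : ℝ}
    (hp : p ∈ Set.Icc (0 : ℝ) 1) {μ : Measure (E → Bool)}
    (hμ : IsBernoulliConfig p μ) {F : ι → Finset E}
    (hF : Pairwise fun i j => Disjoint (F i) (F j)) (J : Finset ι) {L : ℝ}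
    (hL : ∀ i ∈ J, ((F i).card : ℝ) ≤ L) :
    μ.real {ω | ∀ i ∈ J, ¬ ∀ e ∈ F i, ω e = true} ≤ Real.exp (-(p ^ L * J.card)) := by
  classical
  have h1 := hμ.real_inter_forall_not_open hp hF J ∅ (fun _ => true) (by simp)
  simp only [Finset.notMem_empty, false_imp_iff, implies_true, true_and, Finset.prod_empty,
    one_mul] at h1
  rw [h1, mul_comm, ← mul_neg, Real.exp_nat_mul, ← Finset.prod_const]
  refine Finset.prod_le_prod (fun i _ => ?_) fun i hi => ?_
  · linarith [pow_le_one₀ hp.1 hp.2 (n := (F i).card)]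
  · have h2 : p ^ L ≤ p ^ (F i).card := by
      rw [← Real.rpow_natCast]
      exact Real.rpow_le_rpow_of_exponent_ge' hp.1 hp.2 (Nat.cast_nonneg _) (hL i hi)
    linarith [Real.one_sub_le_exp_neg (p ^ L)]

theorem CheegerLB.le_card_cut {V : Type*} [Fintype V] [DecidableEq V] {G : SimpleGraph V}
    [DecidableRel G.Adj] {h : ℝ} (hG : CheegerLB G h) (hpos : 0 < h) {t : ℝ} (S : Finset V)
    (hS : t ≤ S.card) (hS' : t ≤ Sᶜ.card) :
    h * t ≤ ((S ×ˢ Sᶜ).filter fun x => G.Adj x.1 x.2).card := by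
  have key : ∀ T : Finset V, 2 * T.card ≤ Fintype.card V →
      h * T.card ≤ ((T ×ˢ Tᶜ).filter fun x => G.Adj x.1 x.2).card := by
    intro T hT
    rcases T.eq_empty_or_nonempty with rfl | hne
    · simp
    have h1 := hG T (by simpa using hne) (by simpa using hT)
    rw [Set.ncard_coe_finset] at h1
    refine h1.trans (Nat.cast_le.mpr ?_)
    refine le_trans ?_ (Finset.card_image_le (f := fun x : V × V => s(x.1, x.2)))
    rw [← Set.ncard_coe_finset]
    refine Set.ncard_le_ncard ?_ (Finset.finite_toSet _)
    rintro e ⟨he, a, ha, b, hb, rfl⟩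
    simp only [Finset.coe_image, Set.mem_image]
    exact ⟨(a, b), by simpa using ⟨⟨ha, hb⟩, he⟩, rfl⟩
  have hcard := S.card_add_card_compl
  rcases le_total (2 * S.card) (Fintype.card V) with hle | hle
  · exact (mul_le_mul_of_nonneg_left hS hpos.le).trans (key S hle)
  · refine (mul_le_mul_of_nonneg_left hS' hpos.le).trans ((key Sᶜ (by omega)).trans ?_)
    refine Nat.cast_le.mpr (Finset.card_le_card_of_injOn Prod.swap ?_ Prod.swap_injective.injOn)
    intro x hx
    simp only [compl_compl, Finset.coe_filter, Finset.mem_product, Finset.mem_compl,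
      Set.mem_ofPred_eq, Prod.fst_swap, Prod.snd_swap] at hx ⊢
    exact ⟨⟨hx.1.2, hx.1.1⟩, hx.2.symm⟩

theorem SimpleGraph.two_mul_card_edgeFinset_le {V : Type*} [Fintype V] (G : SimpleGraph V)
    [DecidableRel G.Adj] {d : ℕ} (hdeg : ∀ v, G.degree v ≤ d) :
    2 * G.edgeFinset.card ≤ Fintype.card V * d := by
  rw [← G.sum_degrees_eq_twice_card_edges]
  simpa using Finset.sum_le_card_nsmul Finset.univ _ d fun v _ => hdeg v

/-- Among pairwise disjoint subsets of a set, the number of those with more than `L` elements is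
controlled by the size of the set. -/
theorem card_filter_lt_card_mul_le {E ι : Type*} [Fintype ι] {F : ι → Finset E}
    (hF : Pairwise fun i j => Disjoint (F i) (F j)) {U : Finset E} (hU : ∀ i, F i ⊆ U)
    (L : ℕ) : (Finset.univ.filter fun i => L < (F i).card).card * (L + 1) ≤ U.card := by
  classical
  calc _ ≤ ∑ i ∈ Finset.univ.filter fun i => L < (F i).card, (F i).card := by
        rw [← smul_eq_mul]
        exact Finset.card_nsmul_le_sum _ _ _ fun i hi => (Finset.mem_filter.mp hi).2
    _ = ((Finset.univ.filter fun i => L < (F i).card).biUnion F).card :=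
        (Finset.card_biUnion fun i _ j _ hij => hF hij).symm
    _ ≤ U.card := Finset.card_le_card (Finset.biUnion_subset.mpr fun i _ => hU i)

/-- Two large disjoint sets in an expander are joined by an open path up to exponentially small
probability. -/
theorem CheegerLB.real_forall_not_openConn_le {V : Type*} [Fintype V] {G : SimpleGraph V} {d : ℕ}
    (hdeg : ∀ v, (G.neighborSet v).ncard ≤ d) {h : ℝ} (hpos : 0 < h) (hG : CheegerLB G h)
    {δ : ℝ} (hδ : 0 < δ) {A B : Finset V} (hAB : Disjoint A B)
    (hA : δ * Fintype.card V / 12 ≤ A.card) (hB : δ * Fintype.card V / 12 ≤ B.card)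
    {ε : ℝ} (hε : ε ∈ Set.Icc (0 : ℝ) 1) {μ : Measure (Sym2 V → Bool)}
    (hμ : IsBernoulliConfig ε μ) :
    μ.real {ω | ∀ a ∈ A, ∀ b ∈ B, ¬ G.OpenConn ω a b} ≤
      Real.exp (-(ε ^ ((12 * d : ℝ) / (h * δ)) * h * δ * Fintype.card V / 24)) := by
  classical
  have := hμ.1
  set n := Fintype.card V
  set L : ℝ := (12 * d : ℝ) / (h * δ) with hL
  have hhδ : 0 < h * δ := mul_pos hpos hδ
  have hL0 : 0 ≤ L := by positivity
  obtain ⟨F, hF, hwalk⟩ := SimpleGraph.exists_edgeDisjoint_walks (G := G) hAB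
      ⌈h * (δ * n / 12)⌉₊ (by
    intro S hAS hSB
    refine Nat.ceil_le.mpr (hG.le_card_cut hpos S (hA.trans ?_) (hB.trans ?_))
    · exact_mod_cast Finset.card_le_card hAS
    · exact_mod_cast Finset.card_le_card (Finset.subset_compl_iff_disjoint_left.mpr hSB))
  set J := Finset.univ.filter fun i => (F i).card ≤ ⌊L⌋₊ with hJ
  have hJcard : h * δ * n / 24 ≤ J.card := by
    have h1 := card_filter_lt_card_mul_le hF (U := G.edgeFinset) (fun i => by
      obtain ⟨a, _, b, _, p, hp⟩ := hwalk i
      intro e he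
      rw [hp, List.mem_toFinset] at he
      simpa using p.edges_subset_edgeSet he) ⌊L⌋₊
    have h2 := G.two_mul_card_edgeFinset_le (d := d) fun v => by
      rw [← G.card_neighborSet_eq_degree, ← Nat.card_eq_fintype_card]
      exact hdeg v
    have h3 : J.card + (Finset.univ.filter fun i => ⌊L⌋₊ < (F i).card).card
        = ⌈h * (δ * n / 12)⌉₊ := by
      simpa [hJ] using Finset.card_filter_add_card_filter_not (s := Finset.univ)
        (fun i => (F i).card ≤ ⌊L⌋₊)
    set q := (Finset.univ.filter fun i => ⌊L⌋₊ < (F i).card).card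
    have h4 : (2 * (q * (L : ℝ)) + 2 * q * (⌊L⌋₊ + 1 - L) : ℝ) ≤ n * d := by
      have : (2 * (q * (⌊L⌋₊ + 1)) : ℝ) ≤ n * d := by
        exact_mod_cast (Nat.mul_le_mul_left 2 h1).trans h2
      linarith
    have h5 : 0 < (⌊L⌋₊ : ℝ) + 1 - L := by linarith [Nat.lt_floor_add_one L]
    have h6 : (J.card : ℝ) + q = ⌈h * (δ * n / 12)⌉₊ := by exact_mod_cast h3
    have h7 := Nat.le_ceil (h * (δ * n / 12))
    suffices (q : ℝ) ≤ h * δ * n / 24 by linarith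
    rcases Nat.eq_zero_or_pos d with hd | hd
    · have hq : (q : ℝ) ≤ 0 := by
        have : q * (⌊L⌋₊ + 1) = 0 := by
          simp only [hd] at h2
          omega
        simp at this
        simp [this]
      have : 0 ≤ h * δ * n / 24 := by positivity
      linarith
    · have hd' : (0 : ℝ) < d := by exact_mod_cast hd
      have h8 : 2 * (q * L) ≤ n * d := by
        have : 0 ≤ 2 * q * (⌊L⌋₊ + 1 - L) := by positivity
        linarith
      have h9 : L * (h * δ) = 12 * d := by rw [hL]; field_simp
      have h10 : (q : ℝ) * 24 * d ≤ h * δ * n * d := by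
        nlinarith [mul_le_mul_of_nonneg_right h8 hhδ.le]
      have := le_of_mul_le_mul_right h10 hd'
      linarith
  have hmono : μ.real {ω | ∀ a ∈ A, ∀ b ∈ B, ¬ G.OpenConn ω a b} ≤
      μ.real {ω | ∀ i ∈ J, ¬ ∀ e ∈ F i, ω e = true} := by
    refine measureReal_mono fun ω hω i _ hopen => ?_
    obtain ⟨a, ha, b, hb, p, hp⟩ := hwalk i
    exact hω a ha b hb (p.openConn fun e he => hopen e (by simpa [hp] using he))
  refine hmono.trans ((hμ.real_forall_not_open_le hε hF J (L := L) fun i hi =>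
    (Nat.le_floor_iff hL0).mp (Finset.mem_filter.mp hi).2).trans (Real.exp_le_exp.mpr ?_))
  have := mul_le_mul_of_nonneg_left hJcard (Real.rpow_nonneg hε.1 L)
  linarith

/-- sprinkling lemma: let `G` be a finite graph with `n` vertices, maximum
degree at most `d` and Cheeger constant at least `h`, and let `C 0, …, C (m-1)` be at most
`n / R` disjoint connected sets of vertices, each of size at least `R`, of total size at least
`δ n / 6`. Under Bernoulli(`ε`) bond percolation, the probability that some partition of the
sets into two groups, each covering at least `δ n / 12` vertices, has no open path joining the
two groups is at most `exp (n/R - ε^(12 d /(h δ)) h δ n / 24)`. -/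
theorem stmt_14 {V : Type*} [Fintype V] (G : SimpleGraph V) (n : ℕ)
    (hn : Fintype.card V = n) (d : ℕ) (hdeg : ∀ v, (G.neighborSet v).ncard ≤ d)
    (h : ℝ) (hpos : 0 < h) (hcheeger : CheegerLB G h)
    (δ : ℝ) (hδ : 0 < δ) (R : ℕ) (hR : 1 ≤ R)
    (m : ℕ) (hm : (m : ℝ) ≤ n / R) (C : Fin m → Finset V)
    (hCdisj : ∀ i j, i ≠ j → Disjoint (C i) (C j))
    (hCconn : ∀ i, (G.induce (C i : Set V)).Connected)
    (hCsize : ∀ i, R ≤ (C i).card)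
    (hCtotal : δ * n / 6 ≤ ∑ i, ((C i).card : ℝ))
    (ε : ℝ) (hε : ε ∈ Set.Icc (0 : ℝ) 1)
    (μ : Measure (Sym2 V → Bool)) (hμ : IsBernoulliConfig ε μ) :
    μ {ω | ∃ I : Finset (Fin m),
        δ * n / 12 ≤ ∑ i ∈ I, ((C i).card : ℝ) ∧
        δ * n / 12 ≤ ∑ i ∈ Iᶜ, ((C i).card : ℝ) ∧
        ∀ a b, (∃ i ∈ I, a ∈ C i) → (∃ j ∈ Iᶜ, b ∈ C j) → ¬ G.OpenConn ω a b} ≤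
      ENNReal.ofReal
        (Real.exp ((n : ℝ) / R - ε ^ ((12 * d : ℝ) / (h * δ)) * h * δ * n / 24)) := by
  classical
  subst hn
  have := hμ.1
  set n := Fintype.card V
  set x : ℝ := ε ^ ((12 * d : ℝ) / (h * δ)) * h * δ * n / 24
  set good : Finset (Finset (Fin m)) := Finset.univ.filter fun I =>
    δ * n / 12 ≤ ∑ i ∈ I, ((C i).card : ℝ) ∧ δ * n / 12 ≤ ∑ i ∈ Iᶜ, ((C i).card : ℝ) with hgood
  set bad : Finset (Fin m) → Set (Sym2 V → Bool) := fun I =>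
    {ω | ∀ a ∈ I.biUnion C, ∀ b ∈ Iᶜ.biUnion C, ¬ G.OpenConn ω a b} with hbad
  have hcard : ∀ I : Finset (Fin m), ((I.biUnion C).card : ℝ) = ∑ i ∈ I, ((C i).card : ℝ) := by
    intro I
    rw [Finset.card_biUnion fun i _ j _ hij => hCdisj i j hij, Nat.cast_sum]
  have hbound : ∀ I ∈ good, μ.real (bad I) ≤ Real.exp (-x) := by
    intro I hI
    obtain ⟨h1, h2⟩ := (Finset.mem_filter.mp hI).2
    refine CheegerLB.real_forall_not_openConn_le hdeg hpos hcheeger hδ ?_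
      (h1.trans_eq (hcard I).symm) (h2.trans_eq (hcard Iᶜ).symm) hε hμ
    refine (Finset.disjoint_biUnion_left _ _ _).mpr fun i hi =>
      (Finset.disjoint_biUnion_right _ _ _).mpr fun j hj => hCdisj i j ?_
    rintro rfl
    exact Finset.mem_compl.mp hj hi
  have hpow : (good.card : ℝ) ≤ Real.exp (n / R) := by
    calc (good.card : ℝ) ≤ (2 : ℝ) ^ m := by
          have := Finset.card_le_univ good
          rw [Fintype.card_finset, Fintype.card_fin] at this
          exact_mod_cast this
      _ ≤ Real.exp 1 ^ m := by
          gcongr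
          linarith [Real.add_one_le_exp 1]
      _ = Real.exp m := by rw [← Real.exp_nat_mul, mul_one]
      _ ≤ Real.exp (n / R) := Real.exp_le_exp.mpr hm
  rw [← ofReal_measureReal]
  refine ENNReal.ofReal_le_ofReal ?_
  calc _ ≤ μ.real (⋃ I ∈ good, bad I) := by
        refine measureReal_mono ?_ (measure_ne_top _ _)
        rintro ω ⟨I, h1, h2, hω⟩
        refine Set.mem_biUnion (x := I) (by simpa [hgood] using ⟨h1, h2⟩) fun a ha b hb => ?_
        exact hω a b (by simpa using ha) (by simpa using hb)
    _ ≤ ∑ I ∈ good, μ.real (bad I) := measureReal_biUnion_finset_le _ _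
    _ ≤ good.card * Real.exp (-x) := by
        rw [← nsmul_eq_mul]
        exact Finset.sum_le_card_nsmul _ _ _ hbound
    _ ≤ Real.exp (n / R) * Real.exp (-x) := by gcongr
    _ = Real.exp (n / R - x) := by rw [← Real.exp_add, sub_eq_add_neg]
end
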